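/- arXiv:1902.07055 — 3 statements merged into one kernel-verified Lean document; each statement's English description precedes it below -/
import Mathlib

section
/- There exists an absolute constant C > 0 such that for every n₀ ∈ ℕ there is a connected simple graph G on n ≥ n₀ vertices with maximum degree at most 3 for which every hub labeling (S_v)_{v∈V} of G satisfies ∑_{v∈V} |S_v| ≥ n · n / 2^{C·√(log₂ n)} (that is, the average hub set size is at least n / 2^{C·√(log₂ n)}). -/
/-- A hub labeling of a (connected) simple graph `G`: a family of finite hub sets
`S v` such that every pair `u, v` has a common hub on a shortest `u`-`v` path. -/
def IsHubLabeling {V : Type*} (G : SimpleGraph V) (S : V → Finset V) : Prop :=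
  ∀ u v : V, ∃ w : V, w ∈ S u ∧ w ∈ S v ∧ G.dist u w + G.dist w v = G.dist u v

namespace SimpleGraph

variable {V : Type*} {G : SimpleGraph V}

/-- A function that grows by at most one along each edge grows by at most the distance. -/
theorem Connected.potential_le_add_dist (hG : G.Connected) {f : V → ℕ}
    (hf : ∀ u v, G.Adj u v → f v ≤ f u + 1) (u v : V) : f v ≤ f u + G.dist u v := by
  have key : ∀ {u v : V} (p : G.Walk u v), f v ≤ f u + p.length := by
    intro u v p
    induction p with
    | nil => simp
    | cons h p ih =>
      have := hf _ _ h
      rw [Walk.length_cons]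
      omega
  obtain ⟨p, hp⟩ := hG.exists_walk_length_eq_dist u v
  exact hp ▸ key p

/-- A set closed under the edges along which a 1-Lipschitz potential grows contains the end of
every path along which the potential grows as fast as possible. -/
theorem Connected.mem_of_potential_eq_add_dist (hG : G.Connected) {f : V → ℕ} {P : V → Prop}
    (hf : ∀ u v, G.Adj u v → f v ≤ f u + 1)
    (hP : ∀ u v, P u → G.Adj u v → f v = f u + 1 → P v) {u v : V} (hu : P u)
    (huv : f v = f u + G.dist u v) : P v := by
  have key : ∀ {u v : V} (p : G.Walk u v), P u → f v = f u + p.length → P v := by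
    intro u v p
    induction p with
    | nil => exact fun h _ ↦ h
    | @cons u w v h p ih =>
      intro hu huv
      have h₁ := hf _ _ h
      have h₂ := hG.potential_le_add_dist hf w v
      have h₃ := dist_le p
      rw [Walk.length_cons] at huv
      exact ih (hP _ _ hu h (by omega)) (by omega)
  obtain ⟨p, hp⟩ := hG.exists_walk_length_eq_dist u v
  exact key p hu (hp ▸ huv)

theorem Iso.dist_le_dist {W : Type*} {H : SimpleGraph W} (e : G ≃g H) (hG : G.Connected)
    (u v : V) : H.dist (e u) (e v) ≤ G.dist u v := by
  obtain ⟨p, hp⟩ := hG.exists_walk_length_eq_dist u v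
  rw [← hp, ← Walk.length_map e.toHom p]
  exact dist_le _

theorem Iso.dist_apply_apply {W : Type*} {H : SimpleGraph W} (e : G ≃g H) (hG : G.Connected)
    (u v : V) : H.dist (e u) (e v) = G.dist u v := by
  refine (e.dist_le_dist hG u v).antisymm ?_
  simpa using e.symm.dist_le_dist (e.connected_iff.mp hG) (e u) (e v)

end SimpleGraph

/-- A bound on the total size of hub labelings of a finite graph can be transported to a graph
on `Fin n`. -/
theorem exists_fin_graph_of_hubLabeling_bound {V : Type*} [Fintype V] (G : SimpleGraph V)
    (hG : G.Connected) {d N : ℕ} (hd : ∀ v, (G.neighborSet v).ncard ≤ d)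
    (hN : ∀ S : V → Finset V, IsHubLabeling G S → N ≤ ∑ v, (S v).card) :
    ∃ H : SimpleGraph (Fin (Fintype.card V)), H.Connected ∧
      (∀ v, (H.neighborSet v).ncard ≤ d) ∧
      ∀ S : Fin (Fintype.card V) → Finset (Fin (Fintype.card V)), IsHubLabeling H S →
        N ≤ ∑ v, (S v).card := by
  classical
  let e := Fintype.equivFin V
  let φ : G.comap e.symm ≃g G := SimpleGraph.Iso.comap e.symm G
  have hH : (G.comap e.symm).Connected := φ.connected_iff.mpr hG
  refine ⟨G.comap e.symm, hH, fun v ↦ ?_, fun S hS ↦ ?_⟩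
  · rw [← Set.ncard_image_of_injective _ e.symm.injective]
    refine (Set.ncard_le_ncard ?_ (Set.toFinite _)).trans (hd (e.symm v))
    rintro _ ⟨w, hw, rfl⟩
    exact hw
  · have := hN (fun v ↦ (S (e v)).map e.symm.toEmbedding) fun u v ↦ by
      obtain ⟨w, hu, hv, hw⟩ := hS (e u) (e v)
      refine ⟨e.symm w, by simpa using hu, by simpa using hv, ?_⟩
      rw [← φ.dist_apply_apply hH, ← φ.dist_apply_apply hH, ← φ.dist_apply_apply hH] at hw
      simpa [φ] using hw
    simp only [Finset.card_map] at this
    rwa [e.sum_comp (fun v ↦ (S v).card)] at this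

namespace RailGraph

/-- `(T, j, b, p)` is the `p`-th vertex of a path of length `4 * s + 4` in block `T`; this path
belongs to the rail of the vector `j` if `b = false`, and to the bridge leaving this rail in block
`T` if `b = true`. -/
abbrev Vertex (ℓ s : ℕ) : Type :=
  Fin (2 * s * ℓ + 1) × (Fin ℓ → Fin (3 * s)) × Bool × Fin (4 * s + 4)

variable {ℓ s : ℕ} [NeZero ℓ]

/-- The coordinate shifted by the bridges of block `T`. -/
def coord (ℓ : ℕ) [NeZero ℓ] (T : ℕ) : Fin ℓ := Fin.ofNat ℓ T

/-- The threshold of block `T`, which determines the extra cost of its bridges. -/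
def threshold (ℓ s : ℕ) (T : ℕ) : ℕ := T / ℓ % s

/-- Consecutive vertices on a rail or on a bridge. -/
def LaneStep : Vertex ℓ s → Vertex ℓ s → Prop := fun (T, j, b, p) (T', j', b', p') ↦
  (T' = T ∧ j' = j ∧ b' = b ∧ p'.val = p.val + 1) ∨
    (T'.val = T.val + 1 ∧ j' = j ∧ b = false ∧ b' = false ∧ p.val + 1 = 4 * s + 4 ∧ p'.val = 0)

/-- Consecutive vertices where a bridge leaves or reaches a rail. -/
def BridgeStep : Vertex ℓ s → Vertex ℓ s → Prop := fun (T, j, b, p) (T', j', b', p') ↦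
  (T' = T ∧ j' = j ∧ b = false ∧ b' = true ∧ p.val = 2 * threshold ℓ s T + 1 ∧ p'.val = 0) ∨
    (T'.val = T.val + 1 ∧
      (∀ i, (j' i).val = (j i).val + if i = coord ℓ T then 1 else 0) ∧
      b = true ∧ b' = false ∧ p.val + 1 = 4 * s + 4 ∧ p'.val = 0)

/-- The graph formed by the rails and bridges. -/
def railGraph (ℓ s : ℕ) [NeZero ℓ] : SimpleGraph (Vertex ℓ s) :=
  SimpleGraph.fromRel fun u v ↦ LaneStep u v ∨ BridgeStep u v

omit [NeZero ℓ] in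
theorem LaneStep.ne {u v : Vertex ℓ s} (h : LaneStep u v) : u ≠ v := by
  rintro rfl
  simp [LaneStep] at h

theorem BridgeStep.ne {u v : Vertex ℓ s} (h : BridgeStep u v) : u ≠ v := by
  rintro rfl
  grind [BridgeStep]

theorem LaneStep.adj {u v : Vertex ℓ s} (h : LaneStep u v) : (railGraph ℓ s).Adj u v :=
  ⟨h.ne, .inl (.inl h)⟩

theorem BridgeStep.adj {u v : Vertex ℓ s} (h : BridgeStep u v) : (railGraph ℓ s).Adj u v :=
  ⟨h.ne, .inl (.inr h)⟩

omit [NeZero ℓ] in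
theorem subsingleton_setOf_laneStep (u : Vertex ℓ s) : {v | LaneStep u v}.Subsingleton := by
  rintro ⟨T, j, b, p⟩ hv ⟨T', j', b', p'⟩ hv'
  simp only [LaneStep, Set.mem_ofPred_eq] at hv hv'
  simp only [Prod.mk.injEq, Fin.ext_iff] at hv hv' ⊢
  have := p.isLt
  have := p'.isLt
  rcases hv with hv | hv <;> rcases hv' with hv' | hv' <;> grind

omit [NeZero ℓ] in
theorem subsingleton_setOf_laneStep_symm (v : Vertex ℓ s) : {u | LaneStep u v}.Subsingleton := by
  rintro ⟨T, j, b, p⟩ hv ⟨T', j', b', p'⟩ hv'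
  simp only [LaneStep, Set.mem_ofPred_eq] at hv hv'
  simp only [Prod.mk.injEq, Fin.ext_iff] at hv hv' ⊢
  rcases hv with hv | hv <;> rcases hv' with hv' | hv' <;> grind

theorem subsingleton_setOf_bridgeStep (u : Vertex ℓ s) :
    {v | BridgeStep u v ∨ BridgeStep v u}.Subsingleton := by
  obtain ⟨T₀, j₀, b₀, p₀⟩ := u
  rintro ⟨T, j, b, p⟩ hv ⟨T', j', b', p'⟩ hv'
  simp only [BridgeStep, Set.mem_ofPred_eq] at hv hv'
  simp only [Prod.mk.injEq, Fin.ext_iff, funext_iff] at hv hv' ⊢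
  rcases hv with (hv | hv) | (hv | hv) <;> rcases hv' with (hv' | hv') | (hv' | hv') <;> grind

theorem ncard_neighborSet_le (u : Vertex ℓ s) : ((railGraph ℓ s).neighborSet u).ncard ≤ 3 := by
  have h : (railGraph ℓ s).neighborSet u ⊆
      {v | LaneStep u v} ∪ {v | LaneStep v u} ∪ {v | BridgeStep u v ∨ BridgeStep v u} := by
    rintro v ⟨-, (h | h) | (h | h)⟩ <;> simp [h]
  have h₁ := Set.ncard_le_one_iff_subsingleton.mpr (subsingleton_setOf_laneStep u)
  have h₂ := Set.ncard_le_one_iff_subsingleton.mpr (subsingleton_setOf_laneStep_symm u)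
  have h₃ := Set.ncard_le_one_iff_subsingleton.mpr (subsingleton_setOf_bridgeStep u)
  have h₄ := Set.ncard_le_ncard h (Set.toFinite _)
  have h₅ := Set.ncard_union_le ({v | LaneStep u v} ∪ {v | LaneStep v u})
    {v | BridgeStep u v ∨ BridgeStep v u}
  have h₆ := Set.ncard_union_le {v | LaneStep u v} {v | LaneStep v u}
  omega

/-- The first vertex of a path of the construction. -/
def head (T : Fin (2 * s * ℓ + 1)) (j : Fin ℓ → Fin (3 * s)) (b : Bool) : Vertex ℓ s :=
  (T, j, b, ⟨0, by omega⟩)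

omit [NeZero ℓ] in
theorem threshold_lt (hs : 0 < s) (T : ℕ) : threshold ℓ s T < s := Nat.mod_lt _ hs

theorem exists_walk_head (T : Fin (2 * s * ℓ + 1)) (j : Fin ℓ → Fin (3 * s)) (b : Bool) (p : ℕ)
    (hp : p < 4 * s + 4) :
    ∃ w : (railGraph ℓ s).Walk (head T j b) (T, j, b, ⟨p, hp⟩), w.length = p := by
  induction p with
  | zero => exact ⟨.nil, rfl⟩
  | succ p ih =>
    obtain ⟨w, hw⟩ := ih (by omega)
    have h : LaneStep (T, j, b, ⟨p, by omega⟩) (T, j, b, ⟨p + 1, hp⟩) := by simp [LaneStep]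
    exact ⟨w.concat h.adj, by simp [hw]⟩

theorem exists_walk_succ {T T' : Fin (2 * s * ℓ + 1)} (hT : T'.val = T.val + 1)
    (j : Fin ℓ → Fin (3 * s)) :
    ∃ w : (railGraph ℓ s).Walk (head T j false) (head T' j false), w.length = 4 * s + 4 := by
  obtain ⟨w, hw⟩ := exists_walk_head T j false (4 * s + 3) (by omega)
  have h : LaneStep (T, j, false, ⟨4 * s + 3, by omega⟩) (head T' j false) := by
    simp [LaneStep, head, hT]
  exact ⟨w.concat h.adj, by simp [hw]⟩

theorem exists_walk_bridge (hs : 0 < s) {T T' : Fin (2 * s * ℓ + 1)} (hT : T'.val = T.val + 1)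
    {j j' : Fin ℓ → Fin (3 * s)}
    (hj : ∀ i, (j' i).val = (j i).val + if i = coord ℓ T then 1 else 0) :
    ∃ w : (railGraph ℓ s).Walk (head T j false) (head T' j' false),
      w.length = 2 * threshold ℓ s T + 1 + 1 + (4 * s + 4) := by
  have ht := threshold_lt (ℓ := ℓ) hs T
  obtain ⟨w, hw⟩ := exists_walk_head T j false (2 * threshold ℓ s T + 1) (by omega)
  obtain ⟨w', hw'⟩ := exists_walk_head T j true (4 * s + 3) (by omega)
  have h : BridgeStep (T, j, false, ⟨2 * threshold ℓ s T + 1, by omega⟩) (head T j true) := by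
    simp [BridgeStep, head]
  have h' : BridgeStep (T, j, true, ⟨4 * s + 3, by omega⟩) (head T' j' false) := by
    simp [BridgeStep, head, hT, hj]
  exact ⟨(w.concat h.adj).append (w'.concat h'.adj), by simp [hw, hw']⟩

theorem reachable_rail (j : Fin ℓ → Fin (3 * s)) (T : ℕ) (hT : T < 2 * s * ℓ + 1) :
    (railGraph ℓ s).Reachable (head 0 j false) (head ⟨T, hT⟩ j false) := by
  induction T with
  | zero => exact .rfl
  | succ T ih =>
    obtain ⟨w, -⟩ := exists_walk_succ (T := ⟨T, by omega⟩) (T' := ⟨T + 1, hT⟩) rfl j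
    exact (ih _).trans w.reachable

theorem reachable_head (hs : 0 < s) (j : Fin ℓ → Fin (3 * s)) :
    (railGraph ℓ s).Reachable (head 0 (fun _ ↦ ⟨0, by omega⟩) false) (head 0 j false) := by
  induction hn : ∑ i, (j i).val using Nat.strong_induction_on generalizing j with
  | _ n ih =>
    by_cases hj : ∀ i, (j i).val = 0
    · rw [show j = fun _ ↦ ⟨0, by omega⟩ from funext fun i ↦ Fin.ext (hj i)]
    · push Not at hj
      obtain ⟨i, hi⟩ := hj
      let j' : Fin ℓ → Fin (3 * s) := Function.update j i ⟨(j i).val - 1, by omega⟩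
      have hlt : ∑ k, (j' k).val < n := by
        rw [← hn]
        refine Finset.sum_lt_sum (fun k _ ↦ ?_) ⟨i, Finset.mem_univ _, ?_⟩
        · by_cases hk : k = i
          · subst hk; simp [j']
          · simp [j', hk]
        · simp [j']; omega
      have hi' : i.val + 1 < 2 * s * ℓ + 1 := by
        have := i.isLt
        nlinarith
      have hc : coord ℓ i.val = i := Fin.ofNat_val_eq_self i
      obtain ⟨w, -⟩ := exists_walk_bridge hs (T := ⟨i.val, by omega⟩) (T' := ⟨i.val + 1, hi'⟩) rfl
        (j := j') (j' := j) fun k ↦ by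
          by_cases hk : k = i
          · subst hk; simp [j', hc]; omega
          · simp [j', hc, hk]
      exact (ih _ hlt j' rfl).trans <| (reachable_rail j' _ _).trans <|
        w.reachable.trans (reachable_rail j _ hi').symm

theorem connected (hs : 0 < s) : (railGraph ℓ s).Connected := by
  have h : ∀ v, (railGraph ℓ s).Reachable (head 0 (fun _ ↦ ⟨0, by omega⟩) false) v := by
    rintro ⟨T, j, b, p, hp⟩
    refine ((reachable_head hs j).trans (reachable_rail j T T.isLt)).trans ?_
    obtain ⟨w, -⟩ := exists_walk_head T j b p hp
    refine .trans ?_ w.reachable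
    cases b with
    | false => exact .rfl
    | true =>
      have ht := threshold_lt (ℓ := ℓ) hs T
      obtain ⟨w', -⟩ := exists_walk_head T j false (2 * threshold ℓ s T + 1) (by omega)
      have h : BridgeStep (T, j, false, ⟨2 * threshold ℓ s T + 1, by omega⟩) (head T j true) := by
        simp [BridgeStep, head]
      exact w'.reachable.trans h.adj.reachable
  exact SimpleGraph.connected_iff_exists_forall_reachable _ |>.mpr ⟨_, h⟩

/-- What a bridge of block `T` saves at the prices `2 * a i + 1`. -/
def gain (a : Fin ℓ → Fin s) (T : ℕ) : ℕ := 2 * a (coord ℓ T) - (2 * threshold ℓ s T + 1)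

/-- What a bridge of block `T` loses at the prices `2 * a i + 1`. -/
def loss (a : Fin ℓ → Fin s) (T : ℕ) : ℕ := 2 * threshold ℓ s T + 1 - 2 * a (coord ℓ T)

/-- A potential certifying shortest paths in which coordinate `i` is shifted in the blocks with
threshold less than `a i`. -/
def potential (a : Fin ℓ → Fin s) : Vertex ℓ s → ℕ := fun (T, j, b, p) ↦
  ∑ τ ∈ Finset.range T, (4 * s + 4 - gain a τ) + ∑ i, (2 * (a i).val + 1) * (j i).val +
    if b then max (2 * threshold ℓ s T + 1) (2 * threshold ℓ s T + 2 + p - loss a T)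
    else min p.val (max (2 * threshold ℓ s T + 1) (p - gain a T))

/-- The number of blocks in `[u, v)` in which coordinate `i` has to be shifted. -/
def offset (a : Fin ℓ → Fin s) (i : Fin ℓ) (u v : ℕ) : ℕ :=
  ∑ τ ∈ Finset.Ico u v, if i = coord ℓ τ ∧ threshold ℓ s τ < a i then 1 else 0

/-- The vertices of the shortest paths that start at `x` and are certified by `potential a`. -/
def OnPath (x a : Fin ℓ → Fin s) : Vertex ℓ s → Prop := fun (T, j, b, p) ↦
  (∀ i, (j i).val = x i + offset a i 0 T) ∧
    (b = true → threshold ℓ s T < a (coord ℓ T)) ∧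
    (b = false → threshold ℓ s T < a (coord ℓ T) → p.val ≤ 2 * threshold ℓ s T + 1)

omit [NeZero ℓ] in
theorem sum_mul_of_shift (a : Fin ℓ → ℕ) {c : Fin ℓ} {j j' : Fin ℓ → ℕ}
    (h : ∀ i, j' i = j i + if i = c then 1 else 0) :
    ∑ i, a i * j' i = ∑ i, a i * j i + a c := by
  simp [h, mul_add, Finset.sum_add_distrib]

theorem offset_succ (a : Fin ℓ → Fin s) (i : Fin ℓ) {u v : ℕ} (h : u ≤ v) :
    offset a i u (v + 1) =
      offset a i u v + if i = coord ℓ v ∧ threshold ℓ s v < a i then 1 else 0 :=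
  Finset.sum_Ico_succ_top h _

theorem potential_laneStep (hs : 0 < s) (a : Fin ℓ → Fin s) {u v : Vertex ℓ s}
    (h : LaneStep u v) :
    potential a u ≤ potential a v ∧ potential a v ≤ potential a u + 1 := by
  obtain ⟨T, j, b, p⟩ := u
  obtain ⟨T', j', b', p'⟩ := v
  have ht := threshold_lt (ℓ := ℓ) hs T
  have ha := (a (coord ℓ T)).isLt
  rcases h with ⟨rfl, rfl, rfl, h⟩ | ⟨hT, rfl, rfl, rfl, hp, hp'⟩
  · cases b' <;> simp only [potential, gain, loss, if_true, Bool.false_eq_true, if_false] <;> omega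
  · simp only [potential, hT, Finset.sum_range_succ, gain, hp', Bool.false_eq_true, if_false]
    omega

theorem potential_bridgeStep (hs : 0 < s) (a : Fin ℓ → Fin s) {u v : Vertex ℓ s}
    (h : BridgeStep u v) :
    potential a u ≤ potential a v ∧ potential a v ≤ potential a u + 1 := by
  obtain ⟨T, j, b, p⟩ := u
  obtain ⟨T', j', b', p'⟩ := v
  have ht := threshold_lt (ℓ := ℓ) hs T
  have ha := (a (coord ℓ T)).isLt
  rcases h with ⟨rfl, rfl, rfl, rfl, hp, hp'⟩ | ⟨hT, hj, rfl, rfl, hp, hp'⟩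
  · simp only [potential, gain, loss, hp, hp', if_true, Bool.false_eq_true, if_false]
    omega
  · simp only [potential, hT, Finset.sum_range_succ, gain, loss, hp', Bool.false_eq_true, if_false,
      if_true, sum_mul_of_shift (fun i ↦ 2 * (a i).val + 1) hj]
    omega

theorem potential_le_of_adj (hs : 0 < s) (a : Fin ℓ → Fin s) (u v : Vertex ℓ s)
    (h : (railGraph ℓ s).Adj u v) : potential a v ≤ potential a u + 1 := by
  rcases h with ⟨-, (h | h) | (h | h)⟩
  · exact (potential_laneStep hs a h).2
  · exact (potential_bridgeStep hs a h).2
  · have := (potential_laneStep hs a h).1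
    omega
  · have := (potential_bridgeStep hs a h).1
    omega

theorem OnPath.of_laneStep (hs : 0 < s) {x a : Fin ℓ → Fin s} {u v : Vertex ℓ s}
    (hu : OnPath x a u) (h : LaneStep u v) (huv : potential a v = potential a u + 1) :
    OnPath x a v := by
  obtain ⟨T, j, b, p⟩ := u
  obtain ⟨T', j', b', p'⟩ := v
  have ht := threshold_lt (ℓ := ℓ) hs T
  have ha := (a (coord ℓ T)).isLt
  obtain ⟨hj, hb, hr⟩ := hu
  rcases h with ⟨rfl, rfl, rfl, h⟩ | ⟨hT, rfl, rfl, rfl, hp, hp'⟩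
  · refine ⟨hj, hb, ?_⟩
    rintro rfl hlt
    have := hr rfl hlt
    simp only [potential, gain, Bool.false_eq_true, if_false] at huv
    omega
  · refine ⟨fun i ↦ ?_, by simp, fun _ _ ↦ by omega⟩
    have hlt : ¬ threshold ℓ s T < a (coord ℓ T) := fun hlt ↦ by
      have := hr rfl hlt
      omega
    rw [hj, hT, offset_succ _ _ (Nat.zero_le _), if_neg, add_zero]
    rintro ⟨rfl, h⟩
    exact hlt h

theorem OnPath.of_bridgeStep (hs : 0 < s) {x a : Fin ℓ → Fin s} {u v : Vertex ℓ s}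
    (hu : OnPath x a u) (h : BridgeStep u v) (huv : potential a v = potential a u + 1) :
    OnPath x a v := by
  obtain ⟨T, j, b, p⟩ := u
  obtain ⟨T', j', b', p'⟩ := v
  have ht := threshold_lt (ℓ := ℓ) hs T
  have ha := (a (coord ℓ T)).isLt
  obtain ⟨hj, hb, hr⟩ := hu
  rcases h with ⟨rfl, rfl, rfl, rfl, hp, hp'⟩ | ⟨hT, hj', rfl, rfl, hp, hp'⟩
  · refine ⟨hj, fun _ ↦ ?_, by simp⟩
    simp only [potential, gain, loss, hp, hp', if_true, Bool.false_eq_true, if_false] at huv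
    omega
  · refine ⟨fun i ↦ ?_, by simp, fun _ _ ↦ by omega⟩
    have hlt := hb rfl
    rw [hj', hj, hT, offset_succ _ _ (Nat.zero_le _), add_assoc]
    congr 2
    by_cases hi : i = coord ℓ T
    · subst hi; simp [hlt]
    · simp [hi]

theorem OnPath.of_adj (hs : 0 < s) {x a : Fin ℓ → Fin s} (u v : Vertex ℓ s)
    (hu : OnPath x a u) (h : (railGraph ℓ s).Adj u v)
    (huv : potential a v = potential a u + 1) : OnPath x a v := by
  rcases h with ⟨-, (h | h) | (h | h)⟩
  · exact hu.of_laneStep hs h huv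
  · exact hu.of_bridgeStep hs h huv
  · have := (potential_laneStep hs a h).1
    omega
  · have := (potential_bridgeStep hs a h).1
    omega

theorem offset_le (a : Fin ℓ → Fin s) (i : Fin ℓ) {T : ℕ} (hT : T ≤ 2 * s * ℓ) :
    offset a i 0 T ≤ 2 * s := by
  rw [offset, ← Finset.card_filter, ← Finset.card_range (2 * s)]
  refine Finset.card_le_card_of_injOn (· / ℓ) (fun τ hτ ↦ ?_) fun τ hτ τ' hτ' h ↦ ?_
  · simp only [Finset.coe_filter, Finset.mem_Ico, Set.mem_ofPred_eq] at hτ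
    simp only [Finset.coe_range, Set.mem_Iio]
    exact Nat.div_lt_of_lt_mul (by linarith)
  · simp only [Finset.coe_filter, Finset.mem_Ico, Set.mem_ofPred_eq] at hτ hτ'
    have h' : τ % ℓ = τ' % ℓ := congrArg Fin.val (hτ.2.1.symm.trans hτ'.2.1)
    rw [← Nat.div_add_mod τ ℓ, ← Nat.div_add_mod τ' ℓ, h']
    simp only at h
    rw [h]

/-- The position at block `T` of the shortest path that starts at `x` and is certified by
`potential a`. -/
def position (x a : Fin ℓ → Fin s) (T : Fin (2 * s * ℓ + 1)) :
    Fin ℓ → Fin (3 * s) := fun i ↦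
  ⟨x i + offset a i 0 T, by
    have := offset_le a i (Nat.lt_succ_iff.mp T.isLt)
    have := (x i).isLt
    omega⟩

theorem onPath_head (x a : Fin ℓ → Fin s) (T : Fin (2 * s * ℓ + 1)) :
    OnPath x a (head T (position x a T) false) := by
  simp [OnPath, head, position]

theorem potential_head (hs : 0 < s) (x a : Fin ℓ → Fin s) (T : Fin (2 * s * ℓ + 1)) :
    potential a (head 0 (position x a 0) false) +
        (railGraph ℓ s).dist (head 0 (position x a 0) false)
          (head T (position x a T) false) =
      potential a (head T (position x a T) false) := by
  have hconn := connected (ℓ := ℓ) hs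
  refine le_antisymm ?_ (hconn.potential_le_add_dist (potential_le_of_adj hs a) _ _)
  obtain ⟨T, hT⟩ := T
  induction T with
  | zero => simp
  | succ T ih =>
    have hT' : T < 2 * s * ℓ + 1 := by omega
    have ih := ih hT'
    have hstep : potential a (head ⟨T, hT'⟩ (position x a ⟨T, hT'⟩) false) +
        (railGraph ℓ s).dist (head ⟨T, hT'⟩ (position x a ⟨T, hT'⟩) false)
          (head ⟨T + 1, hT⟩ (position x a ⟨T + 1, hT⟩) false) ≤
        potential a (head ⟨T + 1, hT⟩ (position x a ⟨T + 1, hT⟩) false) := by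
      have ht := threshold_lt (ℓ := ℓ) hs T
      have ha := (a (coord ℓ T)).isLt
      by_cases hlt : threshold ℓ s T < a (coord ℓ T)
      · have hj : ∀ i, (position x a ⟨T + 1, hT⟩ i).val =
            (position x a ⟨T, hT'⟩ i).val + if i = coord ℓ T then 1 else 0 := fun i ↦ by
          simp only [position, offset_succ _ _ (Nat.zero_le _), ← add_assoc]
          congr 1
          by_cases hi : i = coord ℓ T
          · subst hi; simp [hlt]
          · simp [hi]
        obtain ⟨w, hw⟩ := exists_walk_bridge hs (T := ⟨T, hT'⟩) (T' := ⟨T + 1, hT⟩) rfl hj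
        have := SimpleGraph.dist_le w
        simp only [potential, head, Finset.sum_range_succ, gain, Bool.false_eq_true, if_false,
          sum_mul_of_shift (fun i ↦ 2 * (a i).val + 1) hj] at this hw ⊢
        omega
      · have hj : position x a ⟨T + 1, hT⟩ = position x a ⟨T, hT'⟩ := funext fun i ↦ by
          simp only [position, offset_succ _ _ (Nat.zero_le _), Fin.mk.injEq]
          rw [if_neg, add_zero]
          rintro ⟨rfl, h⟩
          exact hlt h
        rw [hj]
        obtain ⟨w, hw⟩ := exists_walk_succ (T := ⟨T, hT'⟩) (T' := ⟨T + 1, hT⟩) rfl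
          (position x a ⟨T, hT'⟩)
        have := SimpleGraph.dist_le w
        simp only [potential, head, Finset.sum_range_succ, gain, Bool.false_eq_true,
          if_false] at this hw ⊢
        omega
    have := hconn.dist_triangle (u := head 0 (position x a 0) false)
      (v := head ⟨T, hT'⟩ (position x a ⟨T, hT'⟩) false)
      (w := head ⟨T + 1, hT⟩ (position x a ⟨T + 1, hT⟩) false)
    omega

theorem onPath_of_dist_add_dist (hs : 0 < s) (x a : Fin ℓ → Fin s) (T : Fin (2 * s * ℓ + 1))
    {w : Vertex ℓ s}
    (hw : (railGraph ℓ s).dist (head 0 (position x a 0) false) w +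
        (railGraph ℓ s).dist w (head T (position x a T) false) =
      (railGraph ℓ s).dist (head 0 (position x a 0) false)
        (head T (position x a T) false)) :
    OnPath x a w := by
  have hconn := connected (ℓ := ℓ) hs
  have h := potential_head hs x a T
  have h₁ := hconn.potential_le_add_dist (potential_le_of_adj hs a)
    (head 0 (position x a 0) false) w
  have h₂ := hconn.potential_le_add_dist (potential_le_of_adj hs a) w
    (head T (position x a T) false)
  exact hconn.mem_of_potential_eq_add_dist (potential_le_of_adj hs a)
    (OnPath.of_adj hs) (onPath_head x a 0) (by omega)

theorem offset_lt_offset {a a' : Fin ℓ → Fin s} {i : Fin ℓ} (h : a i < a' i) {k u v : ℕ}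
    (hu : u ≤ (s * k + a i) * ℓ + i) (hv : (s * k + a i) * ℓ + i < v) :
    offset a i u v < offset a' i u v := by
  refine Finset.sum_lt_sum (fun τ _ ↦ ?_)
    ⟨(s * k + a i) * ℓ + i, Finset.mem_Ico.mpr ⟨hu, hv⟩, ?_⟩
  · split_ifs <;> omega
  · have hc : coord ℓ ((s * k + a i) * ℓ + i) = i := by
      ext
      simp [coord, Nat.mod_eq_of_lt]
    have ht : threshold ℓ s ((s * k + a i) * ℓ + i) = a i := by
      rw [threshold, mul_comm _ ℓ, Nat.mul_add_div (NeZero.pos ℓ), Nat.div_eq_of_lt i.isLt,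
        add_zero, Nat.mul_add_mod, Nat.mod_eq_of_lt (a i).isLt]
    simp [hc, ht, h]

theorem eq_of_offset_eq {a a' : Fin ℓ → Fin s} {k u v : ℕ} (hu : u ≤ s * k * ℓ)
    (hv : s * (k + 1) * ℓ ≤ v) (h : ∀ i, offset a i u v = offset a' i u v) : a = a' := by
  have key : ∀ {a a' : Fin ℓ → Fin s}, (∀ i, offset a i u v = offset a' i u v) →
      ∀ i, ¬ a i < a' i := by
    intro a a' h i hlt
    have hi := i.isLt
    have ha := (a i).isLt
    refine (offset_lt_offset hlt (k := k) (u := u) (v := v) ?_ ?_).ne (h i)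
    · nlinarith
    · nlinarith
  exact funext fun i ↦ le_antisymm (not_lt.mp (key (fun i ↦ (h i).symm) i)) (not_lt.mp (key h i))

theorem offset_add_offset (a : Fin ℓ → Fin s) (i : Fin ℓ) {T T' : ℕ} (h : T ≤ T') :
    offset a i 0 T + offset a i T T' = offset a i 0 T' :=
  Finset.sum_Ico_consecutive _ (Nat.zero_le _) h

theorem card_le_sum_card_hubs (hs : 0 < s) {S : Vertex ℓ s → Finset (Vertex ℓ s)}
    (hS : IsHubLabeling (railGraph ℓ s) S) : s ^ (2 * ℓ) ≤ ∑ v, (S v).card := by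
  classical
  let source (q : (Fin ℓ → Fin s) × (Fin ℓ → Fin s)) : Vertex ℓ s :=
    head 0 (position q.1 q.2 0) false
  let target (q : (Fin ℓ → Fin s) × (Fin ℓ → Fin s)) : Vertex ℓ s :=
    head (Fin.last _) (position q.1 q.2 (Fin.last _)) false
  choose hub hsource htarget hdist using fun q ↦ hS (source q) (target q)
  have hpath q : OnPath q.1 q.2 (hub q) := onPath_of_dist_add_dist hs q.1 q.2 _ (hdist q)
  let code (q : (Fin ℓ → Fin s) × (Fin ℓ → Fin s)) : (_ : Vertex ℓ s) × Vertex ℓ s :=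
    if s * ℓ ≤ (hub q).1 then ⟨source q, hub q⟩ else ⟨target q, hub q⟩
  have hne q q' : source q ≠ target q' := fun h ↦ by
    have h := congrArg (fun v : Vertex ℓ s ↦ v.1.val) h
    have := Nat.mul_pos hs (NeZero.pos ℓ)
    simp only [source, target, head, Fin.val_zero, Fin.val_last] at h
    nlinarith
  have hmem q : code q ∈ Finset.univ.sigma S := by
    simp only [code]
    split_ifs <;> simp [hsource, htarget]
  have hinj : Function.Injective code := by
    intro q q' h
    have hq := (hpath q).1
    have hq' := (hpath q').1
    have hT := (hub q).1.isLt
    simp only [code] at h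
    split_ifs at h with h₁ h₂ h₂
    · have hst : source q = source q' := congrArg Sigma.fst h
      have hub_eq : hub q = hub q' := eq_of_heq (Sigma.mk.inj h).2
      have hx i : (q.1 i).val = q'.1 i := by
        have h := congrArg (fun v : Vertex ℓ s ↦ (v.2.1 i).val) hst
        simpa [source, head, position, offset] using h
      refine Prod.ext (funext fun i ↦ Fin.ext (hx i)) <|
        eq_of_offset_eq (k := 0) (u := 0) (v := (hub q).1) (by simp) (by simpa using h₁) fun i ↦ ?_
      have hqi := hq i
      have hqi' := hq' i
      rw [← hub_eq] at hqi'
      have := hx i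
      omega
    · exact absurd (congrArg Sigma.fst h) (hne _ _)
    · exact absurd (congrArg Sigma.fst h).symm (hne _ _)
    · have hst : target q = target q' := congrArg Sigma.fst h
      have hub_eq : hub q = hub q' := eq_of_heq (Sigma.mk.inj h).2
      have hz i : (q.1 i).val + offset q.2 i 0 (2 * s * ℓ) =
          q'.1 i + offset q'.2 i 0 (2 * s * ℓ) := by
        have h := congrArg (fun v : Vertex ℓ s ↦ (v.2.1 i).val) hst
        simpa [target, head, position] using h
      rw [← hub_eq] at hq'
      have hoff : q.2 = q'.2 := by
        refine eq_of_offset_eq (k := 1) (u := (hub q).1) (v := 2 * s * ℓ) (by linarith)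
          (by linarith) fun i ↦ ?_
        have := hq i
        have := hq' i
        have := hz i
        have := offset_add_offset q.2 i (Nat.lt_succ_iff.mp hT)
        have := offset_add_offset q'.2 i (Nat.lt_succ_iff.mp hT)
        omega
      refine Prod.ext (funext fun i ↦ Fin.ext ?_) hoff
      have := hz i
      rw [hoff] at this
      omega
  calc s ^ (2 * ℓ) = (Finset.univ : Finset ((Fin ℓ → Fin s) × (Fin ℓ → Fin s))).card := by
        simp [two_mul, pow_add]
    _ ≤ (Finset.univ.sigma S).card :=
        Finset.card_le_card_of_injOn code (fun q _ ↦ hmem q) hinj.injOn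
    _ = ∑ v, (S v).card := Finset.card_sigma _ _

omit [NeZero ℓ] in
theorem card_vertex (ℓ s : ℕ) :
    Fintype.card (Vertex ℓ s) = (2 * s * ℓ + 1) * ((3 * s) ^ ℓ * (2 * (4 * s + 4))) := by
  simp

theorem two_pow_le_card_vertex (ℓ : ℕ) : 2 ^ (ℓ * ℓ) ≤ Fintype.card (Vertex ℓ (2 ^ ℓ)) := by
  rw [card_vertex, pow_mul]
  calc (2 ^ ℓ) ^ ℓ ≤ (3 * 2 ^ ℓ) ^ ℓ := Nat.pow_le_pow_left (by omega) _
    _ ≤ (3 * 2 ^ ℓ) ^ ℓ * (2 * (4 * 2 ^ ℓ + 4)) := Nat.le_mul_of_pos_right _ (by omega)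
    _ ≤ _ := Nat.le_mul_of_pos_left _ (by omega)

theorem card_vertex_le_two_pow {ℓ : ℕ} (hℓ : 0 < ℓ) :
    Fintype.card (Vertex ℓ (2 ^ ℓ)) ≤ 2 ^ (ℓ * ℓ + 11 * ℓ) := by
  have h₁ : 1 ≤ 2 ^ ℓ := Nat.one_le_two_pow
  have h₂ : ℓ < 2 ^ ℓ := Nat.lt_two_pow_self
  rw [card_vertex, mul_pow, ← pow_mul]
  calc (2 * 2 ^ ℓ * ℓ + 1) * (3 ^ ℓ * 2 ^ (ℓ * ℓ) * (2 * (4 * 2 ^ ℓ + 4)))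
      ≤ (4 * 2 ^ ℓ * 2 ^ ℓ) * (4 ^ ℓ * 2 ^ (ℓ * ℓ) * (16 * 2 ^ ℓ)) := by
        refine Nat.mul_le_mul (by nlinarith) (Nat.mul_le_mul ?_ (by omega))
        exact Nat.mul_le_mul_right _ (Nat.pow_le_pow_left (by norm_num) _)
    _ = 2 ^ (ℓ * ℓ + 5 * ℓ + 6) := by
        rw [show 4 = 2 ^ 2 by norm_num, ← pow_mul]
        ring
    _ ≤ 2 ^ (ℓ * ℓ + 11 * ℓ) := Nat.pow_le_pow_right two_pos (by omega)

end RailGraph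

/-- There is an absolute constant `C > 0` such that for every `n₀` there is a connected
graph on `n ≥ n₀` vertices of maximum degree at most `3` in which every hub labeling has
total hub size at least `n · n / 2^(C·√(log₂ n))`. -/
theorem hub_labeling_lower_bound_sparse :
    ∃ C : ℝ, 0 < C ∧
      ∀ n₀ : ℕ, ∃ n : ℕ, n₀ ≤ n ∧
        ∃ G : SimpleGraph (Fin n), G.Connected ∧
          (∀ v : Fin n, (G.neighborSet v).ncard ≤ 3) ∧
          ∀ S : Fin n → Finset (Fin n), IsHubLabeling G S →
            (n : ℝ) * ((n : ℝ) / 2 ^ (C * Real.sqrt (Real.logb 2 n))) ≤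
              ∑ v : Fin n, ((S v).card : ℝ) := by
  refine ⟨22, by norm_num, fun n₀ ↦ ?_⟩
  obtain ⟨ℓ, hℓ⟩ : ∃ ℓ, ℓ = n₀ + 1 := ⟨_, rfl⟩
  have : NeZero ℓ := ⟨by omega⟩
  have hs : 0 < 2 ^ ℓ := by positivity
  obtain ⟨G, hG, hd, hS⟩ := exists_fin_graph_of_hubLabeling_bound
    (RailGraph.railGraph ℓ (2 ^ ℓ)) (RailGraph.connected hs) RailGraph.ncard_neighborSet_le
    fun S hS ↦ RailGraph.card_le_sum_card_hubs hs hS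
  have hlow := RailGraph.two_pow_le_card_vertex ℓ
  have hup := RailGraph.card_vertex_le_two_pow (ℓ := ℓ) (by omega)
  generalize Fintype.card (RailGraph.Vertex ℓ (2 ^ ℓ)) = n at *
  refine ⟨n, ?_, G, hG, hd, fun S hSG ↦ ?_⟩
  · have : ℓ < 2 ^ (ℓ * ℓ) :=
      Nat.lt_two_pow_self.trans_le (Nat.pow_le_pow_right two_pos (Nat.le_mul_self ℓ))
    omega
  have hlow' : (2 : ℝ) ^ (ℓ * ℓ) ≤ n := by exact_mod_cast hlow
  have hup' : (n : ℝ) ≤ 2 ^ (ℓ * ℓ + 11 * ℓ) := by exact_mod_cast hup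
  have hsum : ((2 : ℝ) ^ ℓ) ^ (2 * ℓ) ≤ ∑ v : Fin n, ((S v).card : ℝ) := by
    exact_mod_cast hS S hSG
  have hn : (0 : ℝ) < n := lt_of_lt_of_le (by positivity) hlow'
  have hlog : (ℓ : ℝ) ≤ Real.sqrt (Real.logb 2 n) := by
    refine Real.le_sqrt_of_sq_le ?_
    rw [Real.le_logb_iff_rpow_le one_lt_two hn]
    refine le_trans (le_of_eq ?_) hlow'
    rw [← pow_two ℓ, ← Nat.cast_pow, Real.rpow_natCast]
  have hpow : (2 : ℝ) ^ (22 * ℓ) ≤ 2 ^ (22 * Real.sqrt (Real.logb 2 n)) := by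
    rw [← Real.rpow_natCast]
    refine Real.rpow_le_rpow_of_exponent_le one_le_two ?_
    push_cast
    linarith
  refine le_trans ?_ hsum
  rw [← mul_div_assoc, div_le_iff₀ (by positivity)]
  calc (n : ℝ) * n ≤ 2 ^ (ℓ * ℓ + 11 * ℓ) * 2 ^ (ℓ * ℓ + 11 * ℓ) := by gcongr
    _ = (2 ^ ℓ) ^ (2 * ℓ) * 2 ^ (22 * ℓ) := by ring
    _ ≤ _ := by gcongr
end

section
/- There exists an absolute constant C > 0 such that for all integers b ≥ 2 and ℓ ≥ 1 the following holds, where m = 2^{(b−1)ℓ} and N = ⌈2^{bℓ + C(b + log₂(ℓ+1))}⌉. Suppose L ∈ ℕ and there exists a decoder d : ({0,1}^L) × ({0,1}^L) → ℕ such that every connected simple graph G with at most N vertices and maximum degree at most 3 admits a labeling label_G : V(G) → {0,1}^L with d(label_G(u), label_G(v)) = dist_G(u,v) for all vertices u,v of G. Then there exist functions A : ({0,1}^m) × Fin m → {0,1}^{L + bℓ}, B : ({0,1}^m) × Fin m → {0,1}^{L + bℓ}, and r : ({0,1}^{L+bℓ}) × ({0,1}^{L+bℓ}) → {0,1} such that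 for every S ∈ {0,1}^m (indexed by Fin m) and all a, a' ∈ Fin m, r(A(S,a), B(S,a')) = S_{(a + a') mod m}. (That is, an L-bit distance labeling scheme for max-degree-3 graphs on N vertices yields a simultaneous-messages protocol for the Sum-Index problem over Z_m with messages of L + bℓ bits.) -/
open Function

namespace SumIndex

section Walks

variable {V : Type*} {G : SimpleGraph V}

/-- There is a walk of length at most `n` from `u` to `v`. -/
def WalkWithin (G : SimpleGraph V) (n : ℤ) (u v : V) : Prop :=
  ∃ p : G.Walk u v, (p.length : ℤ) ≤ n

lemma WalkWithin.refl (u : V) : WalkWithin G 0 u u := ⟨.nil, by simp⟩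

lemma WalkWithin.mono {m n : ℤ} {u v : V} (h : WalkWithin G m u v) (hmn : m ≤ n) :
    WalkWithin G n u v :=
  ⟨h.choose, h.choose_spec.trans hmn⟩

lemma WalkWithin.trans {m n : ℤ} {u v x : V} (h₁ : WalkWithin G m u v)
    (h₂ : WalkWithin G n v x) : WalkWithin G (m + n) u x := by
  obtain ⟨p, hp⟩ := h₁
  obtain ⟨q, hq⟩ := h₂
  exact ⟨p.append q, by rw [SimpleGraph.Walk.length_append]; push_cast; omega⟩

lemma WalkWithin.of_adj {u v : V} (h : G.Adj u v) : WalkWithin G 1 u v :=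
  ⟨h.toWalk, by simp⟩

lemma WalkWithin.reachable {n : ℤ} {u v : V} (h : WalkWithin G n u v) : G.Reachable u v :=
  ⟨h.choose⟩

lemma WalkWithin.dist_le {n : ℤ} {u v : V} (h : WalkWithin G n u v) : (G.dist u v : ℤ) ≤ n := by
  obtain ⟨p, hp⟩ := h
  exact (Int.ofNat_le.2 (SimpleGraph.dist_le p)).trans hp

lemma sub_le_dist_of_adj {f : V → ℤ} (hf : ∀ u v, G.Adj u v → f v ≤ f u + 1) {u v : V}
    (huv : G.Reachable u v) : f v - f u ≤ G.dist u v := by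
  obtain ⟨p, hp⟩ := huv.exists_walk_length_eq_dist
  rw [← hp]
  clear hp huv
  induction p with
  | nil => simp
  | cons h p ih =>
    have := hf _ _ h
    rw [SimpleGraph.Walk.length_cons]
    push_cast
    omega

end Walks

section Subdivision

variable {V E : Type*} (src : E → V) (tgt : E → Option V) (w : E → ℕ) (K : ℕ)

/-- Arcs of `subdivision`. -/
def subdivisionRel : V ⊕ E × Fin K → V ⊕ E × Fin K → Prop
  | .inl v, .inr (e, t) => (src e = v ∧ t.1 = 0) ∨ (tgt e = some v ∧ t.1 + 1 = w e)
  | .inr (e, t), .inr (e', t') => e = e' ∧ t.1 + 1 = t'.1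
  | _, _ => False

/-- Every `e : E` contributes a path with `K` inner vertices starting at `src e`; its `w e`-th
inner vertex is joined to `tgt e`, if there is one, so that `e` acts as an edge of length
`w e + 1`. -/
def subdivision : SimpleGraph (V ⊕ E × Fin K) :=
  SimpleGraph.fromRel (subdivisionRel src tgt w K)

variable {src tgt w K}

lemma subdivision_adj_of_rel {u v : V ⊕ E × Fin K} (h : subdivisionRel src tgt w K u v) :
    (subdivision src tgt w K).Adj u v := by
  refine (SimpleGraph.fromRel_adj _ _ _).2 ⟨?_, .inl h⟩
  rintro rfl
  rcases u with v | ⟨e, t⟩ <;> simp [subdivisionRel] at h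

lemma subdivision_walk_inner (e : E) (n : ℕ) (hn : n < K) :
    WalkWithin (subdivision src tgt w K) (n + 1) (.inl (src e)) (.inr (e, ⟨n, hn⟩)) := by
  induction n with
  | zero =>
    have : subdivisionRel src tgt w K (.inl (src e)) (.inr (e, ⟨0, hn⟩)) := Or.inl ⟨rfl, rfl⟩
    exact (WalkWithin.of_adj (subdivision_adj_of_rel this)).mono (by simp)
  | succ n ih =>
    have : subdivisionRel src tgt w K (.inr (e, ⟨n, by omega⟩)) (.inr (e, ⟨n + 1, hn⟩)) :=
      ⟨rfl, rfl⟩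
    exact ((ih (by omega)).trans
      (WalkWithin.of_adj (subdivision_adj_of_rel this))).mono (by push_cast; omega)

lemma subdivision_walk (hw : ∀ e, 1 ≤ w e) (hK : ∀ e, w e ≤ K) {e : E} {v : V}
    (he : tgt e = some v) :
    WalkWithin (subdivision src tgt w K) (w e + 1) (.inl (src e)) (.inl v) := by
  have h1 := hw e
  have h2 := hK e
  have : subdivisionRel src tgt w K (.inl v) (.inr (e, ⟨w e - 1, by omega⟩)) :=
    Or.inr ⟨he, Nat.sub_add_cancel h1⟩
  exact ((subdivision_walk_inner e (w e - 1) (by omega)).trans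
    (WalkWithin.of_adj (subdivision_adj_of_rel this).symm)).mono (by omega)

lemma subdivision_connected {v₀ : V}
    (h : ∀ v, (subdivision src tgt w K).Reachable (.inl v₀) (.inl v)) :
    (subdivision src tgt w K).Connected := by
  refine SimpleGraph.connected_iff_exists_forall_reachable _ |>.2 ⟨.inl v₀, ?_⟩
  rintro (v | ⟨e, t⟩)
  · exact h v
  · exact (h _).trans (subdivision_walk_inner e t.1 t.2).reachable

lemma subdivision_sub_le_dist (f : V → ℤ)
    (hf : ∀ e v, tgt e = some v → |f v - f (src e)| ≤ w e + 1) {u v : V}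
    (huv : (subdivision src tgt w K).Reachable (.inl u) (.inl v)) :
    f v - f u ≤ (subdivision src tgt w K).dist (.inl u) (.inl v) := by
  classical
  let Δ : E → ℤ := fun e => (tgt e).elim 0 (fun v => f v - f (src e))
  let F : V ⊕ E × Fin K → ℤ := Sum.elim f
    (fun x => f (src x.1) + max (-((x.2.1 : ℤ) + 1)) (min ((x.2.1 : ℤ) + 1) (Δ x.1)))
  have key : ∀ a c, subdivisionRel src tgt w K a c → F c ≤ F a + 1 ∧ F a ≤ F c + 1 := by
    rintro (a | ⟨e, t⟩) (c | ⟨e', t'⟩) h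
    · exact h.elim
    · rcases h with ⟨rfl, h⟩ | ⟨he, h⟩
      · simp only [F, Sum.elim_inl, Sum.elim_inr, h]
        omega
      · have h1 := abs_le.1 (hf _ _ he)
        have h2 : Δ e' = f a - f (src e') := by simp [Δ, he]
        simp only [F, Sum.elim_inl, Sum.elim_inr, h2]
        omega
    · exact h.elim
    · obtain ⟨rfl, h⟩ := h
      simp only [F, Sum.elim_inr]
      omega
  refine sub_le_dist_of_adj (f := F) (fun a c hac => ?_) huv
  rcases (SimpleGraph.fromRel_adj _ _ _).1 hac with ⟨-, h | h⟩
  · exact (key _ _ h).1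
  · exact (key _ _ h).2

lemma subdivision_ncard_neighborSet_le [Finite E]
    (hdeg : ∀ v, {e | src e = v}.ncard + {e | tgt e = some v}.ncard ≤ 3)
    (x : V ⊕ E × Fin K) : ((subdivision src tgt w K).neighborSet x).ncard ≤ 3 := by
  classical
  rcases x with v | ⟨e, t⟩
  · rcases Nat.eq_zero_or_pos K with rfl | hK
    · have : (subdivision src tgt w 0).neighborSet (.inl v) = ∅ := by
        ext (y | ⟨e, t⟩)
        · simp [subdivision, subdivisionRel]
        · exact t.elim0
      simp [this]
    have : (subdivision src tgt w K).neighborSet (.inl v) ⊆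
        ((fun e => .inr (e, ⟨0, hK⟩)) '' {e | src e = v}) ∪
        ((fun e => .inr (e, ⟨(w e - 1) % K, Nat.mod_lt _ hK⟩)) '' {e | tgt e = some v}) := by
      rintro (y | ⟨e, t⟩) hy
      · simp [subdivision, subdivisionRel] at hy
      · rcases (SimpleGraph.fromRel_adj _ _ _).1 hy with ⟨-, (⟨h, h'⟩ | ⟨h, h'⟩) | h⟩
        · exact .inl ⟨e, h, by simp [Fin.ext_iff, h']⟩
        · refine .inr ⟨e, h, ?_⟩
          have : (w e - 1) % K = t.1 := by
            have := t.2
            rw [Nat.mod_eq_of_lt] <;> omega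
          simp [this]
        · exact h.elim
    calc _ ≤ _ := Set.ncard_le_ncard this (Set.toFinite _)
      _ ≤ _ := Set.ncard_union_le _ _
      _ ≤ _ := add_le_add (Set.ncard_image_le (Set.toFinite _))
        (Set.ncard_image_le (Set.toFinite _))
      _ ≤ 3 := hdeg v
  · let pred : V ⊕ E × Fin K :=
      if t.1 = 0 then .inl (src e) else .inr (e, ⟨t.1 - 1, by omega⟩)
    let next : V ⊕ E × Fin K :=
      if h : t.1 + 1 < K then .inr (e, ⟨t.1 + 1, h⟩) else .inl (src e)
    let last : V ⊕ E × Fin K := .inl ((tgt e).getD (src e))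
    have : (subdivision src tgt w K).neighborSet (.inr (e, t)) ⊆
        (({pred, next, last} : Finset (V ⊕ E × Fin K)) : Set (V ⊕ E × Fin K)) := by
      rintro (v | ⟨e', t'⟩) hy
      · rcases (SimpleGraph.fromRel_adj _ _ _).1 hy with ⟨-, h | ⟨h, h'⟩ | ⟨h, h'⟩⟩
        · exact h.elim
        · simp [pred, h, h']
        · simp [last, h]
      · rcases (SimpleGraph.fromRel_adj _ _ _).1 hy with ⟨-, ⟨h, h'⟩ | ⟨h, h'⟩⟩
        · have : t.1 + 1 < K := by omega
          simp [next, h, h']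
        · have : t.1 ≠ 0 := by omega
          have h2 : t'.1 = t.1 - 1 := by omega
          simp [pred, h, this, Fin.ext_iff, h2]
    calc _ ≤ _ := Set.ncard_le_ncard this (Set.toFinite _)
      _ ≤ 3 := by rw [Set.ncard_coe_finset]; exact Finset.card_le_three

end Subdivision

section Transfer

lemma dist_map_le {V W : Type*} {G : SimpleGraph V} {H : SimpleGraph W} (φ : G →g H)
    (hG : G.Connected) (u v : V) : H.dist (φ u) (φ v) ≤ G.dist u v := by
  obtain ⟨p, hp⟩ := hG.exists_walk_length_eq_dist u v
  rw [← hp, ← SimpleGraph.Walk.length_map φ p]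
  exact SimpleGraph.dist_le _

/-- A labeling scheme for graphs on `Fin n` applies to graphs on any finite type. -/
lemma exists_labeling_of_card_le {L N : ℕ} {d : (Fin L → Bool) → (Fin L → Bool) → ℕ}
    (h : ∀ n : ℕ, n ≤ N → ∀ G : SimpleGraph (Fin n), G.Connected →
      (∀ v : Fin n, (G.neighborSet v).ncard ≤ 3) →
      ∃ lab : Fin n → (Fin L → Bool), ∀ u v : Fin n, d (lab u) (lab v) = G.dist u v)
    {W : Type*} [Fintype W] (hW : Fintype.card W ≤ N) (G : SimpleGraph W) (hG : G.Connected)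
    (hdeg : ∀ v, (G.neighborSet v).ncard ≤ 3) :
    ∃ lab : W → (Fin L → Bool), ∀ u v, d (lab u) (lab v) = G.dist u v := by
  let e := Fintype.equivFin W
  let φ : G.comap e.symm ≃g G := SimpleGraph.Iso.comap e.symm G
  have hH := φ.connected_iff.2 hG
  obtain ⟨lab, hlab⟩ := h _ hW (G.comap e.symm) hH (fun v => by
    have : (G.comap e.symm).neighborSet v = e.symm ⁻¹' (G.neighborSet (e.symm v)) := rfl
    rw [this, Set.ncard_preimage_of_injective_subset_range e.symm.injective (by simp)]
    exact hdeg _)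
  refine ⟨fun x => lab (e x), fun u v => (hlab _ _).trans (le_antisymm ?_ ?_)⟩
  · exact dist_map_le φ.symm.toHom hG u v
  · have := dist_map_le φ.toHom hH (e u) (e v)
    have h' : ∀ x, φ.toHom (e x) = x := fun x => e.symm_apply_apply x
    rwa [h', h'] at this

end Transfer

section Network

variable {ℓ s : ℕ}

/-- A layer, a vector and a value of the coordinate that the layer rewrites. -/
abbrev Port (ℓ s : ℕ) : Type := Fin (2 * ℓ + 1) × (Fin ℓ → Fin s) × Fin s

/-- Crossbar nodes. A row node `inl (i, v, q)` belongs to vector `v` entering layer `i`, about to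
overwrite the active coordinate by `q`. A column node `inr (i, v, p)` belongs to vector `v`
leaving layer `i`, whose active coordinate was `p` before. -/
abbrev Node (ℓ s : ℕ) : Type := Port ℓ s ⊕ Port ℓ s

/-- The edges leaving row nodes along their row, those crossing from row to column nodes, and
those leaving column nodes along their column. -/
abbrev Edge (ℓ s : ℕ) : Type := Port ℓ s ⊕ Port ℓ s ⊕ Port ℓ s

def edgeSrc : Edge ℓ s → Node ℓ s
  | .inl u => .inl u
  | .inr (.inl u) => .inl u
  | .inr (.inr u) => .inr u

lemma edgeSrc_ncard_row (u : Port ℓ s) : {e : Edge ℓ s | edgeSrc e = .inl u}.ncard ≤ 2 := by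
  classical
  have : {e : Edge ℓ s | edgeSrc e = .inl u} ⊆
      (({.inl u, .inr (.inl u)} : Finset (Edge ℓ s)) : Set (Edge ℓ s)) := by
    rintro (e | e | e) h <;> simp_all [edgeSrc]
  calc _ ≤ _ := Set.ncard_le_ncard this (Set.toFinite _)
    _ ≤ 2 := by rw [Set.ncard_coe_finset]; exact Finset.card_le_two

lemma edgeSrc_ncard_col (u : Port ℓ s) : {e : Edge ℓ s | edgeSrc e = .inr u}.ncard ≤ 1 := by
  rw [Set.ncard_le_one (Set.toFinite _)]
  rintro (e | e | e) h (e' | e' | e') h' <;> simp_all [edgeSrc]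

/-- The cost of a layer that leaves its active coordinate unchanged. -/
def layerCost (s : ℕ) : ℤ := s ^ 2 + 4 * s + 4

/-- The number of inner vertices of an edge. A vector `v` with `σ v = false` pays one extra unit
when passing the middle layer. -/
def edgeWeight [NeZero ℓ] (σ : (Fin ℓ → Fin s) → Bool) : Edge ℓ s → ℕ
  | .inl _ => 1
  | .inr (.inl (i, v, q)) =>
    (layerCost s + ((q : ℤ) - v (Fin.ofNat ℓ i)) ^ 2 - 2 * v (Fin.ofNat ℓ i) - 2 * q - 3).toNat
  | .inr (.inr (i, v, p)) => if p.1 = 0 ∧ i.1 + 1 = ℓ ∧ σ v = false then 2 else 1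

def edgeTgt [NeZero ℓ] : Edge ℓ s → Option (Node ℓ s)
  | .inl (i, v, q) => if h : q.1 + 1 < s then some (.inl (i, v, ⟨q.1 + 1, h⟩)) else none
  | .inr (.inl (i, v, q)) =>
    some (.inr (i, update v (Fin.ofNat ℓ i) q, v (Fin.ofNat ℓ i)))
  | .inr (.inr (i, v, p)) =>
    if p.1 = 0 then
      if h : i.1 + 1 < 2 * ℓ + 1 then some (.inl (⟨i.1 + 1, h⟩, v, p)) else none
    else some (.inr (i, v, ⟨p.1 - 1, by omega⟩))

/-- An upper bound for the edge weights. -/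
def maxWeight (s : ℕ) : ℕ := 2 * s ^ 2 + 4 * s + 4

/-- The layered crossbar network on vectors `Fin ℓ → Fin s`. -/
def network [NeZero ℓ] (σ : (Fin ℓ → Fin s) → Bool) :
    SimpleGraph (Node ℓ s ⊕ Edge ℓ s × Fin (maxWeight s)) :=
  subdivision edgeSrc edgeTgt (edgeWeight σ) (maxWeight s)

/-- The vertex at which vector `v` enters layer `i`. -/
def entry [NeZero s] (i : ℕ) (hi : i < 2 * ℓ + 1) (v : Fin ℓ → Fin s) : Node ℓ s :=
  .inl (⟨i, hi⟩, v, 0)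

section

variable [NeZero ℓ] (σ : (Fin ℓ → Fin s) → Bool)

lemma edgeWeight_cross (i : Fin (2 * ℓ + 1)) (v : Fin ℓ → Fin s) (q : Fin s) :
    (edgeWeight σ (.inr (.inl (i, v, q))) : ℤ) =
      layerCost s + ((q : ℤ) - v (Fin.ofNat ℓ i)) ^ 2 - 2 * v (Fin.ofNat ℓ i) - 2 * q - 3 := by
  rw [edgeWeight, Int.toNat_of_nonneg]
  have h1 := q.2
  have h2 := (v (Fin.ofNat ℓ i)).2
  have h3 := sq_nonneg ((q : ℤ) - v (Fin.ofNat ℓ i))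
  have h4 := sq_nonneg (s : ℤ)
  unfold layerCost
  omega

lemma one_le_edgeWeight (e : Edge ℓ s) : 1 ≤ edgeWeight σ e := by
  rcases e with u | ⟨i, v, q⟩ | ⟨i, v, p⟩
  · simp [edgeWeight]
  · have := edgeWeight_cross σ i v q
    have h1 := q.2
    have h2 := (v (Fin.ofNat ℓ i)).2
    have h3 := sq_nonneg ((q : ℤ) - v (Fin.ofNat ℓ i))
    have h4 := sq_nonneg (s : ℤ)
    unfold layerCost at this
    omega
  · simp only [edgeWeight]
    split_ifs <;> omega

lemma edgeWeight_le (e : Edge ℓ s) : edgeWeight σ e ≤ maxWeight s := by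
  unfold maxWeight
  rcases e with u | ⟨i, v, q⟩ | ⟨i, v, p⟩
  · simp only [edgeWeight]
    omega
  · have := edgeWeight_cross σ i v q
    have h1 : (q : ℤ) < s := by exact_mod_cast q.2
    have h2 : (v (Fin.ofNat ℓ i) : ℤ) < s := by exact_mod_cast (v (Fin.ofNat ℓ i)).2
    have h3 : ((q : ℤ) - v (Fin.ofNat ℓ i)) ^ 2 ≤ s ^ 2 :=
      sq_le_sq' (by omega) (by omega)
    unfold layerCost at this
    zify
    omega
  · simp only [edgeWeight]
    split_ifs <;> omega

lemma edgeTgt_ncard_row (u : Port ℓ s) : {e : Edge ℓ s | edgeTgt e = some (.inl u)}.ncard ≤ 1 := by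
  obtain ⟨i, v, q⟩ := u
  let pred : Edge ℓ s :=
    if q.1 = 0 then .inr (.inr (⟨i.1 - 1, by omega⟩, v, q)) else .inl (i, v, ⟨q.1 - 1, by omega⟩)
  have : {e : Edge ℓ s | edgeTgt e = some (.inl (i, v, q))} ⊆ {pred} := by
    rintro (⟨i₁, v₁, q₁⟩ | ⟨i₁, v₁, q₁⟩ | ⟨i₁, v₁, q₁⟩) h₁ <;>
    simp only [edgeTgt, Set.mem_ofPred_eq] at h₁
    · split_ifs at h₁
      simp only [Option.some.injEq, Sum.inl.injEq, Prod.mk.injEq] at h₁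
      obtain ⟨rfl, rfl, rfl⟩ := h₁
      simp [pred]
    · simp at h₁
    · split_ifs at h₁
      · simp only [Option.some.injEq, Sum.inl.injEq, Prod.mk.injEq] at h₁
        obtain ⟨rfl, rfl, rfl⟩ := h₁
        simp [pred, *]
      · simp at h₁
  exact (Set.ncard_le_ncard this (Set.toFinite _)).trans (by simp)

lemma edgeTgt_ncard_col (u : Port ℓ s) : {e : Edge ℓ s | edgeTgt e = some (.inr u)}.ncard ≤ 2 := by
  classical
  obtain ⟨i, v, p⟩ := u
  let c := Fin.ofNat ℓ i
  let next : Edge ℓ s :=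
    if h : p.1 + 1 < s then .inr (.inr (i, v, ⟨p.1 + 1, h⟩)) else .inr (.inr (i, v, p))
  have : {e : Edge ℓ s | edgeTgt e = some (.inr (i, v, p))} ⊆
      (({.inr (.inl (i, update v c p, v c)), next} : Finset (Edge ℓ s)) : Set (Edge ℓ s)) := by
    rintro (⟨i₁, v₁, q₁⟩ | ⟨i₁, v₁, q₁⟩ | ⟨i₁, v₁, q₁⟩) h₁ <;>
    simp only [edgeTgt, Set.mem_ofPred_eq] at h₁
    · split_ifs at h₁
      simp at h₁
    · simp only [Option.some.injEq, Sum.inr.injEq, Prod.mk.injEq] at h₁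
      obtain ⟨rfl, rfl, rfl⟩ := h₁
      simp [c]
    · split_ifs at h₁
      · simp at h₁
      · simp only [Option.some.injEq, Sum.inr.injEq, Prod.mk.injEq] at h₁
        obtain ⟨rfl, rfl, rfl⟩ := h₁
        have h₂ := q₁.2
        have h₃ : q₁.1 - 1 + 1 = q₁.1 := by omega
        simp [next, h₃]
  calc _ ≤ _ := Set.ncard_le_ncard this (Set.toFinite _)
    _ ≤ 2 := by rw [Set.ncard_coe_finset]; exact Finset.card_le_two

lemma network_ncard_neighborSet_le (x) : ((network σ).neighborSet x).ncard ≤ 3 := by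
  refine subdivision_ncard_neighborSet_le ?_ x
  rintro (u | u)
  · exact add_le_add (edgeSrc_ncard_row u) (edgeTgt_ncard_row u)
  · exact add_le_add (edgeSrc_ncard_col u) (edgeTgt_ncard_col u)

lemma network_walk {e : Edge ℓ s} {v : Node ℓ s} (he : edgeTgt e = some v) :
    WalkWithin (network σ) (edgeWeight σ e + 1) (.inl (edgeSrc e)) (.inl v) :=
  subdivision_walk (one_le_edgeWeight σ) (edgeWeight_le σ) he

lemma network_walk_row [NeZero s] (i : Fin (2 * ℓ + 1)) (v : Fin ℓ → Fin s) (n : ℕ) (hn : n < s) :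
    WalkWithin (network σ) (2 * n) (.inl (.inl (i, v, 0))) (.inl (.inl (i, v, ⟨n, hn⟩))) := by
  induction n with
  | zero => exact (WalkWithin.refl _).mono (by simp)
  | succ n ih =>
    have : edgeTgt (.inl (i, v, ⟨n, by omega⟩)) = some (.inl (i, v, ⟨n + 1, hn⟩)) := by
      simp [edgeTgt, hn]
    exact ((ih (by omega)).trans (network_walk σ this)).mono
      (by simp only [edgeWeight]; push_cast; omega)

lemma network_walk_col [NeZero s] (i : Fin (2 * ℓ + 1)) (v : Fin ℓ → Fin s) (n : ℕ) (hn : n < s) :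
    WalkWithin (network σ) (2 * n) (.inl (.inr (i, v, ⟨n, hn⟩))) (.inl (.inr (i, v, 0))) := by
  induction n with
  | zero => exact (WalkWithin.refl _).mono (by simp)
  | succ n ih =>
    have : edgeTgt (.inr (.inr (i, v, ⟨n + 1, hn⟩))) = some (.inr (i, v, ⟨n, by omega⟩)) := by
      simp [edgeTgt]
    exact ((network_walk σ this).trans (ih (by omega))).mono
      (by simp [edgeWeight]; omega)

lemma network_walk_layer [NeZero s] (i : ℕ) (hi : i + 1 < 2 * ℓ + 1) (v : Fin ℓ → Fin s)
    (q : Fin s) :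
    WalkWithin (network σ)
      (layerCost s + ((q : ℤ) - v (Fin.ofNat ℓ i)) ^ 2 +
        if i + 1 = ℓ ∧ σ (update v (Fin.ofNat ℓ i) q) = false then 1 else 0)
      (.inl (entry i (by omega) v)) (.inl (entry (i + 1) hi (update v (Fin.ofNat ℓ i) q))) := by
  let i' : Fin (2 * ℓ + 1) := ⟨i, by omega⟩
  have h₁ := network_walk_row σ i' v q q.2
  have h₂ := network_walk σ (e := .inr (.inl (i', v, q))) rfl
  have h₃ := network_walk_col σ i' (update v (Fin.ofNat ℓ i) q) (v (Fin.ofNat ℓ i)) (Fin.is_lt _)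
  have h₄ := network_walk σ (e := .inr (.inr (i', update v (Fin.ofNat ℓ i) q, 0)))
    (v := entry (i + 1) hi (update v (Fin.ofNat ℓ i) q)) (by simp [edgeTgt, i', entry]; omega)
  refine (((h₁.trans h₂).trans h₃).trans h₄).mono ?_
  rw [edgeWeight_cross]
  simp only [edgeWeight, i', Fin.val_zero, true_and]
  split_ifs <;> push_cast <;> omega

lemma network_reachable_entry [NeZero s] (i : ℕ) (hi : i < 2 * ℓ + 1) (v : Fin ℓ → Fin s) :
    (network σ).Reachable (.inl (entry 0 (by omega) v)) (.inl (entry i hi v)) := by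
  induction i with
  | zero => rfl
  | succ i ih =>
    have := (network_walk_layer σ i hi v (v (Fin.ofNat ℓ i))).reachable
    rw [update_eq_self] at this
    exact (ih (by omega)).trans this

lemma network_reachable_update [NeZero s] (v : Fin ℓ → Fin s) (j : Fin ℓ) (q : Fin s) :
    (network σ).Reachable (.inl (entry 0 (by omega) v))
      (.inl (entry 0 (by omega) (update v j q))) := by
  have hj : Fin.ofNat ℓ j = j := by simp
  have := (network_walk_layer σ j (by omega) v q).reachable
  rw [hj] at this
  exact ((network_reachable_entry σ j (by omega) v).trans this).trans
    (network_reachable_entry σ (j + 1) (by omega) _).symm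

lemma network_connected [NeZero s] : (network σ).Connected := by
  refine subdivision_connected (v₀ := entry 0 (by omega) 0) fun x => ?_
  change (network σ).Reachable _ _
  have hvec : ∀ v : Fin ℓ → Fin s, (network σ).Reachable (.inl (entry 0 (by omega) 0))
      (.inl (entry 0 (by omega) v)) := by
    intro v
    have : ∀ t : Finset (Fin ℓ), (network σ).Reachable (.inl (entry 0 (by omega) 0))
        (.inl (entry 0 (by omega) (t.piecewise v 0))) := by
      intro t
      induction t using Finset.induction with
      | empty => simp
      | insert j t hj ih =>
        rw [Finset.piecewise_insert]
        exact ih.trans (network_reachable_update σ _ j _)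
    simpa using this Finset.univ
  have hrow : ∀ u, (network σ).Reachable (.inl (entry 0 (by omega) 0)) (.inl (.inl u)) :=
    fun ⟨i, v, q⟩ => ((hvec v).trans (network_reachable_entry σ i i.2 v)).trans
      (network_walk_row σ i v q q.2).reachable
  rcases x with u | ⟨i, v, p⟩
  · exact hrow u
  · refine (hrow (i, update v (Fin.ofNat ℓ i) p, v (Fin.ofNat ℓ i))).trans
      (network_walk σ (e := .inr (.inl _)) ?_).reachable
    simp [edgeTgt]

end

/-- The first `k` coordinates of `y` followed by the remaining ones of `x`. -/
def mix (x y : Fin ℓ → Fin s) (k : ℕ) : Fin ℓ → Fin s := fun j => if j.1 < k then y j else x j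

lemma mix_zero (x y : Fin ℓ → Fin s) : mix x y 0 = x := by
  ext j; simp [mix]

lemma mix_self (x y : Fin ℓ → Fin s) : mix x y ℓ = y := by
  ext j; simp [mix]

lemma update_mix (x y : Fin ℓ → Fin s) (j : Fin ℓ) :
    update (mix x y j) j (y j) = mix x y (j + 1) := by
  funext l
  by_cases hl : l = j
  · subst hl; simp [mix]
  · have : l.1 ≠ j.1 := fun h => hl (Fin.ext h)
    rw [update_of_ne hl, mix, mix]
    exact if_congr (by omega) rfl rfl

section Distances

variable [NeZero ℓ] (σ : (Fin ℓ → Fin s) → Bool)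

/-- A potential for the network whose slope in each coordinate is `2 * h`. Crossing a layer by
`δ` raises it by `layerCost s + δ ^ 2 - (δ - h) ^ 2`. -/
def potential (h : Fin ℓ → ℤ) (i : ℕ) (v : Fin ℓ → Fin s) : ℤ :=
  i * layerCost s + ∑ j, 2 * h j * (v j : ℤ) - ∑ k ∈ Finset.range i, h (Fin.ofNat ℓ k) ^ 2

lemma potential_succ_update (h : Fin ℓ → ℤ) (i : ℕ) (v : Fin ℓ → Fin s) (q : Fin s) :
    potential h (i + 1) (update v (Fin.ofNat ℓ i) q) = potential h i v + layerCost s +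
      2 * h (Fin.ofNat ℓ i) * ((q : ℤ) - v (Fin.ofNat ℓ i)) - h (Fin.ofNat ℓ i) ^ 2 := by
  set c := Fin.ofNat ℓ i
  have : ∀ y : Fin ℓ → Fin s, ∑ j, 2 * h j * (y j : ℤ) =
      2 * h c * (y c : ℤ) + ∑ j ∈ Finset.univ.erase c, 2 * h j * (y j : ℤ) := fun y =>
    (Finset.add_sum_erase _ _ (Finset.mem_univ c)).symm
  have h' : ∑ j ∈ Finset.univ.erase c, 2 * h j * (update v c q j : ℤ) =
      ∑ j ∈ Finset.univ.erase c, 2 * h j * (v j : ℤ) :=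
    Finset.sum_congr rfl fun j hj => by rw [update_of_ne (Finset.ne_of_mem_erase hj)]
  rw [potential, potential, this v, this (update v c q), h', update_self, Finset.sum_range_succ]
  push_cast
  ring

lemma network_walk_mix [NeZero s] {x y : Fin ℓ → Fin s} {h : Fin ℓ → ℤ}
    (hxy : ∀ j, (y j : ℤ) - x j = h j) (o : ℕ) (ho : o = 0 ∧ σ y = true ∨ o = ℓ)
    (k : ℕ) (hk : k ≤ ℓ) :
    WalkWithin (network σ) (potential h (o + k) (mix x y k) - potential h o x)
      (.inl (entry o (by omega) x)) (.inl (entry (o + k) (by omega) (mix x y k))) := by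
  induction k with
  | zero => simpa [mix_zero] using WalkWithin.refl _
  | succ k ih =>
    let j : Fin ℓ := ⟨k, by omega⟩
    have hj : Fin.ofNat ℓ (o + k) = j := by
      apply Fin.ext
      rcases ho with ⟨rfl, -⟩ | rfl <;> simp [j, Nat.mod_eq_of_lt (Nat.lt_of_succ_le hk)]
    have hu : update (mix x y k) j (y j) = mix x y (k + 1) := update_mix x y j
    have hm : mix x y k j = x j := by simp [mix, j]
    have hw := network_walk_layer σ (o + k) (by omega) (mix x y k) (y j)
    have hp := potential_succ_update h (o + k) (mix x y k) (y j)
    rw [hj, hu, hm, hxy] at hp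
    simp only [hj, hu, hm, hxy] at hw
    refine ((ih (by omega)).trans hw).mono ?_
    rw [if_neg, ← add_assoc o k 1, hp]
    · apply le_of_eq
      ring
    · rintro ⟨h₁, h₂⟩
      rcases ho with ⟨rfl, h₃⟩ | rfl
      · rw [show k + 1 = ℓ by omega, mix_self, h₃] at h₂
        simp at h₂
      · omega

/-- If `w` is the midpoint of `x` and `z` and is not penalized, the potential difference bounds
the distance of `x` and `z` from above. -/
lemma network_dist_le [NeZero s] {x w z : Fin ℓ → Fin s} {h : Fin ℓ → ℤ}
    (hxw : ∀ j, (w j : ℤ) - x j = h j) (hwz : ∀ j, (z j : ℤ) - w j = h j) (hw : σ w = true) :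
    ((network σ).dist (.inl (entry 0 (by omega) x)) (.inl (entry (2 * ℓ) (by omega) z)) : ℤ) ≤
      potential h (2 * ℓ) z - potential h 0 x := by
  have h₁ := network_walk_mix σ hxw 0 (.inl ⟨rfl, hw⟩) ℓ le_rfl
  have h₂ := network_walk_mix σ hwz ℓ (.inr rfl) ℓ le_rfl
  simp only [mix_self, zero_add, ← two_mul] at h₁ h₂
  refine ((h₁.trans h₂).mono ?_).dist_le
  apply le_of_eq
  ring

/-- If `w` is penalized, passing it or leaving the straight line from `x` through `w` costs at
least one unit more than the potential difference. -/
lemma network_lt_dist [NeZero s] {x w : Fin ℓ → Fin s} (z : Fin ℓ → Fin s) {h : Fin ℓ → ℤ}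
    (hxw : ∀ j, (w j : ℤ) - x j = h j) (hw : σ w = false) :
    potential h (2 * ℓ) z - potential h 0 x <
      (network σ).dist (.inl (entry 0 (by omega) x)) (.inl (entry (2 * ℓ) (by omega) z)) := by
  have hℓ : 0 < ℓ := Nat.pos_of_neZero ℓ
  let gIn : ℕ → (Fin ℓ → Fin s) → ℤ := fun i v => if i < ℓ ∧ v = mix x w i then 0 else 1
  let gOut : ℕ → (Fin ℓ → Fin s) → ℤ := fun i v => if i ≤ ℓ ∧ v = mix x w i then 0 else 1
  let f : Node ℓ s → ℤ := Sum.elim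
    (fun u => potential h u.1 u.2.1 + 2 * u.2.2 + gIn u.1 u.2.1)
    (fun u => potential h (u.1 + 1) u.2.1 - 2 * u.2.2 - 2 + gOut (u.1 + 1) u.2.1)
  have key := subdivision_sub_le_dist (K := maxWeight s) (w := edgeWeight σ) f ?_
    ((network_connected σ).preconnected (.inl (entry 0 (by omega) x))
      (.inl (entry (2 * ℓ) (by omega) z)))
  · have h₁ : gIn 0 x = 0 := by simp [gIn, mix_zero, hℓ]
    have h₂ : gIn (2 * ℓ) z = 1 := if_neg (by omega)
    simp only [f, entry, Sum.elim_inl, h₁, h₂, Fin.val_zero] at key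
    unfold network entry
    omega
  rintro (⟨i, v, q⟩ | ⟨i, v, q⟩ | ⟨i, v, p⟩) y hy
  · simp only [edgeTgt] at hy
    split_ifs at hy
    cases hy
    simp only [f, edgeSrc, edgeWeight, Sum.elim_inl, abs_le]
    push_cast
    omega
  · cases hy
    rw [edgeWeight_cross, abs_le]
    simp only [f, edgeSrc, Sum.elim_inl, Sum.elim_inr]
    rw [potential_succ_update]
    set c := Fin.ofNat ℓ i with hc
    have hq : (q : ℤ) < s := by exact_mod_cast q.2
    have hv : (v c : ℤ) < s := by exact_mod_cast (v c).2
    have hwc : (w c : ℤ) < s := by exact_mod_cast (w c).2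
    have hxc : (x c : ℤ) < s := by exact_mod_cast (x c).2
    have hh : h c ^ 2 ≤ (s : ℤ) ^ 2 := by
      rw [← hxw]
      exact sq_le_sq' (by omega) (by omega)
    have hsq := sq_nonneg ((q : ℤ) - v c + h c)
    have hsq' := sq_nonneg ((q : ℤ) - v c - h c)
    have hin : gIn i v = 0 ∨ gIn i v = 1 := by
      simp only [gIn]; split_ifs <;> simp
    have hout : gOut (i + 1) (update v c q) = 0 ∨ gOut (i + 1) (update v c q) = 1 := by
      simp only [gOut]; split_ifs <;> simp
    have hslack : gOut (i + 1) (update v c q) - gIn i v ≤ ((q : ℤ) - v c - h c) ^ 2 := by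
      by_cases hg : i < ℓ ∧ v = mix x w i
      · obtain ⟨hi, hvi⟩ := hg
        have hci : c.1 = i := by simp [hc, Nat.mod_eq_of_lt hi]
        have hvc : v c = x c := by rw [hvi, mix, if_neg (by omega)]
        by_cases hqw : q = w c
        · have : update v c q = mix x w (i + 1) := by
            rw [hvi, hqw, ← hci, update_mix]
          have : gOut (i + 1) (update v c q) = 0 := if_pos ⟨hi, this⟩
          omega
        · have hne : (q : ℤ) - v c - h c ≠ 0 := by
            rw [← hxw, hvc]
            have : q.1 ≠ (w c).1 := fun h => hqw (Fin.ext h)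
            omega
          have := sq_pos_of_ne_zero hne
          omega
      · have : gIn i v = 1 := if_neg hg
        omega
    have hdrop : -1 ≤ gOut (i + 1) (update v c q) - gIn i v := by omega
    unfold layerCost
    constructor <;> nlinarith
  · simp only [edgeTgt] at hy
    split_ifs at hy with hp hi
    · cases hy
      have hio : gIn (i + 1) v ≤ gOut (i + 1) v + 1 := by
        simp only [gIn, gOut]; split_ifs <;> simp
      have hoi : gOut (i + 1) v ≤ gIn (i + 1) v := by
        by_cases hg : i.1 + 1 < ℓ ∧ v = mix x w (i + 1)
        · exact le_of_eq ((if_pos ⟨hg.1.le, hg.2⟩).trans (if_pos hg).symm)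
        · have : gIn (i + 1) v = 1 := if_neg hg
          rw [this]
          simp only [gOut]
          split_ifs <;> simp
      simp only [f, edgeSrc, Sum.elim_inl, Sum.elim_inr, edgeWeight, hp, true_and, abs_le]
      split_ifs with hσ
      · push_cast
        omega
      · have : gIn (i + 1) v = gOut (i + 1) v := by
          simp only [gIn, gOut]
          refine if_congr (and_congr_left fun hv => ⟨le_of_lt, fun hle => ?_⟩) rfl rfl
          refine lt_of_le_of_ne hle fun heq => hσ ⟨heq, ?_⟩
          rw [hv, heq, mix_self, hw]
        push_cast
        omega
    · cases hy
      simp only [f, edgeSrc, Sum.elim_inr, edgeWeight, hp, false_and, if_false, abs_le]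
      omega

end Distances

lemma card_network_le (hs : 4 ≤ s) :
    Fintype.card (Node ℓ s ⊕ Edge ℓ s × Fin (maxWeight s)) ≤ s ^ ℓ * (s ^ 6 * (ℓ + 1)) := by
  have hport : Fintype.card (Port ℓ s) = (2 * ℓ + 1) * (s ^ ℓ * s) := by simp
  have hcard : Fintype.card (Node ℓ s ⊕ Edge ℓ s × Fin (maxWeight s)) =
      (2 * ℓ + 1) * (s ^ ℓ * s) * (2 + 3 * (2 * s ^ 2 + 4 * s + 4)) := by
    rw [Fintype.card_sum, Fintype.card_prod, Fintype.card_sum, Fintype.card_sum,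
      Fintype.card_sum, Fintype.card_fin, hport, maxWeight]
    ring
  rw [hcard]
  have h₁ : 2 + 3 * (2 * s ^ 2 + 4 * s + 4) ≤ 16 * s ^ 2 := by nlinarith
  have h₂ : 32 * s ^ 3 ≤ s ^ 6 := by
    have : 4 ^ 3 ≤ s ^ 3 := Nat.pow_le_pow_left hs 3
    nlinarith [Nat.zero_le (s ^ 3)]
  calc _ = s ^ ℓ * (s * (2 * ℓ + 1) * (2 + 3 * (2 * s ^ 2 + 4 * s + 4))) := by ring
    _ ≤ s ^ ℓ * (s * (2 * (ℓ + 1)) * (16 * s ^ 2)) := by gcongr; omega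
    _ = s ^ ℓ * (32 * s ^ 3 * (ℓ + 1)) := by ring
    _ ≤ _ := by gcongr

end Network

/-- The value of a digit vector `v` in base `t`, as an element of `Fin m`. -/
def digitValue {ℓ s m : ℕ} [NeZero m] (t : ℕ) (v : Fin ℓ → Fin s) : Fin m :=
  Fin.ofNat m (∑ j, v j * t ^ j.1)

/-- Sum-Index over `Fin (t ^ ℓ)` reduces to distances in networks on `Fin ℓ → Fin (2 * t)`. -/
lemma exists_network_reduction (ℓ t : ℕ) [NeZero ℓ] [NeZero t] :
    ∃ (p q : Fin (t ^ ℓ) → Node ℓ (2 * t)) (D : Fin (t ^ ℓ) → Fin (t ^ ℓ) → ℤ),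
      ∀ S : Fin (t ^ ℓ) → Bool, ∀ a a',
        decide (((network fun v => S (digitValue t v)).dist (.inl (p a)) (.inl (q a')) : ℤ) ≤
          D a a') = S (a + a') := by
  let dig : Fin (t ^ ℓ) → Fin ℓ → Fin t := finFunctionFinEquiv.symm
  have hdig : ∀ a, ∑ j, (dig a j : ℕ) * t ^ j.1 = a := fun a => by
    rw [← finFunctionFinEquiv_apply, Equiv.apply_symm_apply]
  let dbl : Fin (t ^ ℓ) → Fin ℓ → Fin (2 * t) := fun a j => ⟨2 * dig a j, by omega⟩
  let h : Fin (t ^ ℓ) → Fin (t ^ ℓ) → Fin ℓ → ℤ := fun a a' j => (dig a' j : ℤ) - dig a j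
  refine ⟨fun a => entry 0 (by omega) (dbl a), fun a => entry (2 * ℓ) (by omega) (dbl a),
    fun a a' => potential (h a a') (2 * ℓ) (dbl a') - potential (h a a') 0 (dbl a),
    fun S a a' => ?_⟩
  let w : Fin ℓ → Fin (2 * t) := fun j => ⟨dig a j + dig a' j, by omega⟩
  have hw : (digitValue t w : Fin (t ^ ℓ)) = a + a' := by
    apply Fin.ext
    simp only [digitValue, Fin.val_ofNat, w, add_mul, Finset.sum_add_distrib, hdig, Fin.val_add]
  have hxw : ∀ j, (w j : ℤ) - dbl a j = h a a' j := fun j => by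
    simp only [w, dbl, h]; push_cast; ring
  have hwz : ∀ j, (dbl a' j : ℤ) - w j = h a a' j := fun j => by
    simp only [w, dbl, h]; push_cast; ring
  rw [← hw]
  cases hS : S (digitValue t w) with
  | true => exact decide_eq_true (network_dist_le (fun v => S (digitValue t v)) hxw hwz hS)
  | false =>
    exact decide_eq_false
      (not_le.2 (network_lt_dist (fun v => S (digitValue t v)) (dbl a') hxw hS))

/-- Messages made of an `L`-bit label and a `k`-bit encoding of the sender's index. -/
lemma exists_protocol {m L k : ℕ} (hm : m ≤ 2 ^ k) {X : Type*}
    (lab : (Fin m → Bool) → X → (Fin L → Bool)) (p q : Fin m → X)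
    (test : (Fin L → Bool) → (Fin L → Bool) → Fin m → Fin m → Bool)
    (f : (Fin m → Bool) → Fin m → Fin m → Bool)
    (h : ∀ S a a', test (lab S (p a)) (lab S (q a')) a a' = f S a a') :
    ∃ (A B : (Fin m → Bool) → Fin m → (Fin (L + k) → Bool))
      (r : (Fin (L + k) → Bool) → (Fin (L + k) → Bool) → Bool),
      ∀ S a a', r (A S a) (B S a') = f S a a' := by
  obtain ⟨enc⟩ : Nonempty (Fin m ↪ (Fin k → Bool)) :=
    Embedding.nonempty_of_card_le (by simpa using hm)
  rcases Nat.eq_zero_or_pos m with rfl | hm₀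
  · exact ⟨fun _ a => a.elim0, fun _ a => a.elim0, fun _ _ => false, fun _ a => a.elim0⟩
  have : Nonempty (Fin m) := ⟨⟨0, hm₀⟩⟩
  let fstPart : (Fin (L + k) → Bool) → (Fin L → Bool) := fun x i => x (Fin.castAdd k i)
  let sndPart : (Fin (L + k) → Bool) → Fin m := fun x => invFun enc fun i => x (Fin.natAdd L i)
  refine ⟨fun S a => Fin.append (lab S (p a)) (enc a), fun S a => Fin.append (lab S (q a)) (enc a),
    fun x y => test (fstPart x) (fstPart y) (sndPart x) (sndPart y), fun S a a' => ?_⟩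
  have h₁ : ∀ l a, fstPart (Fin.append l (enc a)) = l := fun l a => by
    funext i; simp [fstPart]
  have h₂ : ∀ l a, sndPart (Fin.append l (enc a)) = a := fun l a => by
    simp [sndPart, leftInverse_invFun enc.injective a]
  simp only [h₁, h₂, h]

end SumIndex


/-- A distance labeling scheme with `L`-bit labels and decoder `d` for max-degree-3
connected graphs on at most `N = ⌈2^{bℓ + C(b + log₂(ℓ+1))}⌉` vertices yields a
simultaneous-messages protocol for Sum-Index over `Z_m`, `m = 2^{(b-1)ℓ}`, with messages
of `L + bℓ` bits: Alice's message `A S a`, Bob's message `B S a'`, and the referee `r`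
recover `S ((a + a') mod m)`. -/
theorem distance_labeling_solves_sum_index :
    ∃ C : ℝ, 0 < C ∧
      ∀ b ℓ : ℕ, 2 ≤ b → 1 ≤ ℓ →
        ∀ L : ℕ, ∀ d : (Fin L → Bool) → (Fin L → Bool) → ℕ,
          (∀ n : ℕ,
              n ≤ ⌈(2 : ℝ) ^ (((b * ℓ : ℕ) : ℝ) + C * ((b : ℝ) + Real.logb 2 ((ℓ : ℝ) + 1)))⌉₊ →
              ∀ G : SimpleGraph (Fin n), G.Connected →
                (∀ v : Fin n, (G.neighborSet v).ncard ≤ 3) →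
                ∃ lab : Fin n → (Fin L → Bool),
                  ∀ u v : Fin n, d (lab u) (lab v) = G.dist u v) →
          ∃ (A B : (Fin (2 ^ ((b - 1) * ℓ)) → Bool) → Fin (2 ^ ((b - 1) * ℓ)) →
                (Fin (L + b * ℓ) → Bool))
            (r : (Fin (L + b * ℓ) → Bool) → (Fin (L + b * ℓ) → Bool) → Bool),
            ∀ (S : Fin (2 ^ ((b - 1) * ℓ)) → Bool) (a a' : Fin (2 ^ ((b - 1) * ℓ))),
              r (A S a) (B S a') = S (a + a') := by
  refine ⟨6, by norm_num, fun b ℓ hb hℓ L d hd => ?_⟩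
  have : NeZero ℓ := ⟨by omega⟩
  have hm : 2 ^ ((b - 1) * ℓ) = (2 ^ (b - 1)) ^ ℓ := pow_mul 2 (b - 1) ℓ
  have hm_le : 2 ^ ((b - 1) * ℓ) ≤ 2 ^ (b * ℓ) :=
    Nat.pow_le_pow_right two_pos (Nat.mul_le_mul_right _ (Nat.sub_le b 1))
  revert hm_le
  rw [hm]
  intro hm_le
  have hs : 2 * 2 ^ (b - 1) = 2 ^ b := by rw [← pow_succ', Nat.sub_add_cancel (by omega)]
  have hcard : Fintype.card (SumIndex.Node ℓ (2 * 2 ^ (b - 1)) ⊕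
      SumIndex.Edge ℓ (2 * 2 ^ (b - 1)) × Fin (SumIndex.maxWeight (2 * 2 ^ (b - 1)))) ≤
      ⌈(2 : ℝ) ^ (((b * ℓ : ℕ) : ℝ) + 6 * ((b : ℝ) + Real.logb 2 ((ℓ : ℝ) + 1)))⌉₊ := by
    have h4 : 4 ≤ 2 * 2 ^ (b - 1) := by
      rw [hs]
      exact (Nat.pow_le_pow_right two_pos hb : 2 ^ 2 ≤ 2 ^ b)
    refine (SumIndex.card_network_le h4).trans
      (Nat.cast_le (α := ℝ).1 (le_trans ?_ (Nat.le_ceil _)))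
    have hpos : (0 : ℝ) < (ℓ : ℝ) + 1 := by positivity
    have hexp : (2 : ℝ) ^ (((b * ℓ : ℕ) : ℝ) + 6 * ((b : ℝ) + Real.logb 2 ((ℓ : ℝ) + 1))) =
        (2 ^ b) ^ ℓ * ((2 ^ b) ^ 6 * ((ℓ : ℝ) + 1) ^ 6) := by
      rw [mul_add, Real.rpow_add two_pos, Real.rpow_add two_pos, Real.rpow_natCast, pow_mul,
        mul_comm (6 : ℝ), mul_comm (6 : ℝ), Real.rpow_mul two_pos.le, Real.rpow_mul two_pos.le,
        Real.rpow_logb two_pos (by norm_num) hpos]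
      norm_cast
    rw [hexp, hs]
    push_cast
    gcongr
    exact le_self_pow₀ (by linarith [Nat.cast_nonneg (α := ℝ) ℓ]) (by norm_num)
  obtain ⟨p, q, D, hD⟩ := SumIndex.exists_network_reduction ℓ (2 ^ (b - 1))
  choose lab hlab using fun S : Fin ((2 ^ (b - 1)) ^ ℓ) → Bool =>
    SumIndex.exists_labeling_of_card_le hd hcard
      (SumIndex.network fun v => S (SumIndex.digitValue (2 ^ (b - 1)) v))
      (SumIndex.network_connected _) (SumIndex.network_ncard_neighborSet_le _)
  refine SumIndex.exists_protocol hm_le lab (fun a => .inl (p a)) (fun a => .inl (q a))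
    (fun x y a a' => decide ((d x y : ℤ) ≤ D a a')) (fun S a a' => S (a + a')) fun S a a' => ?_
  rw [hlab]
  exact hD S a a'
end

section
/- There exists an absolute constant C > 0 such that the following holds. Let n ≥ 2 and let R be a real number with 2^6 ≤ R ≤ n^6, and suppose the Ruzsa–Szemerédi bound with parameter R holds at 2n. Then every connected simple graph G on n vertices with maximum degree at most Δ admits a hub labeling (S_v)_{v∈V} with ∑_{v∈V} |S_v| ≤ C · (Δ+1) · n² / R^{1/7}. -/
/-- `M` is an induced matching of `G`: a set of edges of `G`, pairwise vertex-disjoint,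
which coincides with the edge set of the subgraph of `G` induced by the endpoints of
edges of `M`. -/
def IsInducedMatching {V : Type*} (G : SimpleGraph V) (M : Set (Sym2 V)) : Prop :=
  M ⊆ G.edgeSet ∧
  (∀ e ∈ M, ∀ f ∈ M, e ≠ f → ∀ v : V, v ∈ e → v ∉ f) ∧
  (∀ e ∈ G.edgeSet, (∀ v : V, v ∈ e → ∃ f ∈ M, v ∈ f) → e ∈ M)

/-- The Ruzsa–Szemerédi bound with parameter `R` holds at `N`: every simple graph on `N`
vertices whose edge set can be partitioned into at most `N` induced matchings has at most
`N²/R` edges. -/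
def RSBoundAt (R : ℝ) (N : ℕ) : Prop :=
  ∀ (G : SimpleGraph (Fin N)) (𝓜 : Finset (Set (Sym2 (Fin N)))),
    𝓜.card ≤ N →
    (∀ M ∈ 𝓜, IsInducedMatching G M) →
    (∀ M₁ ∈ 𝓜, ∀ M₂ ∈ 𝓜, M₁ ≠ M₂ → Disjoint M₁ M₂) →
    (⋃ M ∈ 𝓜, M) = G.edgeSet →
    (G.edgeSet.ncard : ℝ) ≤ (N : ℝ) ^ 2 / R


open Finset in
/-- Greedy hitting set: `t` points suffice to hit all but a `(1 - d / n) ^ t` fraction of a family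
of sets of size at least `d` in an `n`-point space. -/
theorem exists_hitting_set {α : Type*} {n : ℕ} (P : Finset α) (H : α → Finset (Fin n)) (d : ℝ)
    (hn : 0 < n) (hdn : d ≤ n) (hH : ∀ p ∈ P, d ≤ (#(H p) : ℝ)) (t : ℕ) :
    ∃ W : Finset (Fin n), #W ≤ t ∧
      (#{p ∈ P | Disjoint (H p) W} : ℝ) ≤ (1 - d / n) ^ t * #P := by
  have hn' : (0 : ℝ) < n := by exact_mod_cast hn
  induction t with
  | zero => exact ⟨∅, by simp, by simp⟩
  | succ t ih =>
    obtain ⟨W, hW, hWP⟩ := ih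
    set P' := {p ∈ P | Disjoint (H p) W} with hP'
    have hcount : ∑ w : Fin n, (#{p ∈ P' | w ∈ H p} : ℝ) = ∑ p ∈ P', (#(H p) : ℝ) := by
      have := sum_card_bipartiteAbove_eq_sum_card_bipartiteBelow (s := (univ : Finset (Fin n)))
        (t := P') (fun w p => w ∈ H p)
      simp only [bipartiteAbove, bipartiteBelow, filter_univ_mem] at this
      exact_mod_cast this
    obtain ⟨w, hw⟩ : ∃ w : Fin n, d / n * #P' ≤ (#{p ∈ P' | w ∈ H p} : ℝ) := by
      by_contra! hlt
      have : Nonempty (Fin n) := ⟨⟨0, hn⟩⟩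
      have h1 := sum_lt_sum_of_nonempty (univ_nonempty (α := Fin n)) fun w _ => hlt w
      have h2 : (#P' : ℝ) * d ≤ ∑ p ∈ P', (#(H p) : ℝ) := by
        rw [← nsmul_eq_mul]
        exact card_nsmul_le_sum _ _ _ fun p hp => hH p (mem_filter.1 hp).1
      rw [hcount] at h1
      simp only [sum_const, card_univ, Fintype.card_fin, nsmul_eq_mul] at h1
      field_simp at h1
      linarith
    refine ⟨insert w W, (card_insert_le _ _).trans (by omega), ?_⟩
    have heq : ({p ∈ P | Disjoint (H p) (insert w W)} : Finset α) = {p ∈ P' | w ∉ H p} := by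
      ext p
      simp only [hP', mem_filter, disjoint_insert_right]
      tauto
    have hsplit : (#{p ∈ P' | w ∈ H p} : ℝ) + #{p ∈ P' | w ∉ H p} = #P' := by
      exact_mod_cast card_filter_add_card_filter_not (s := P') (fun p => w ∈ H p)
    have hfac : 0 ≤ 1 - d / n := by
      rw [sub_nonneg, div_le_one hn']
      exact hdn
    rw [heq]
    calc (#{p ∈ P' | w ∉ H p} : ℝ) ≤ (1 - d / n) * #P' := by linarith
      _ ≤ (1 - d / n) * ((1 - d / n) ^ t * #P) := by gcongr
      _ = _ := by ring

open Finset in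
theorem card_colorings_collision_mul_le {n K : ℕ} {x y : Fin n} (hxy : x ≠ y) :
    #{f : Fin n → Fin K | f x = f y} * K ≤ Fintype.card (Fin n → Fin K) := by
  classical
  have : #(({f | f x = f y} : Finset (Fin n → Fin K)) ×ˢ (univ : Finset (Fin K))) ≤
      #(univ : Finset (Fin n → Fin K)) := by
    refine card_le_card_of_injOn (fun p => Function.update p.1 x p.2) (by simp) ?_
    rintro ⟨f, k⟩ hf ⟨g, l⟩ hg h
    simp only [coe_product, Set.mem_prod, mem_coe, mem_filter, mem_univ, true_and,
      and_true] at hf hg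
    have hz : ∀ z, Function.update f x k z = Function.update g x l z := congrFun h
    have hne : ∀ z, z ≠ x → f z = g z := fun z hzx => by simpa [hzx] using hz z
    have hk : k = l := by simpa using hz x
    refine Prod.ext (funext fun z => ?_) hk
    by_cases hzx : z = x
    · rw [hzx]; exact hf.trans ((hne y hxy.symm).trans hg.symm)
    · exact hne z hzx
  simpa [card_product] using this

open Finset Classical in
/-- Some coloring with `K` colors is injective on all but a `T ^ 2 / K` fraction of a family of
sets of size at most `T`. -/
theorem exists_coloring {α : Type*} {n K T : ℕ} (hK : 0 < K) (P : Finset α)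
    (H : α → Finset (Fin n)) (hH : ∀ p ∈ P, #(H p) ≤ T) :
    ∃ f : Fin n → Fin K, #{p ∈ P | ¬ Set.InjOn f (H p)} * K ≤ #P * T ^ 2 := by
  have : Nonempty (Fin K) := ⟨⟨0, hK⟩⟩
  have key : ∀ p ∈ P, #{f : Fin n → Fin K | ¬ Set.InjOn f (H p)} * K ≤
      T ^ 2 * Fintype.card (Fin n → Fin K) := by
    intro p hp
    have hsub : ({f : Fin n → Fin K | ¬ Set.InjOn f (H p)} : Finset _) ⊆
        (H p).offDiag.biUnion fun q => {f : Fin n → Fin K | f q.1 = f q.2} := by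
      intro f hf
      have hf' : ¬ Set.InjOn f (H p) := (mem_filter.1 hf).2
      rw [Set.InjOn] at hf'
      push Not at hf'
      obtain ⟨x, hx, y, hy, hxy, hne⟩ := hf'
      simp only [mem_biUnion, mem_offDiag, mem_filter, mem_univ, true_and]
      exact ⟨(x, y), ⟨hx, hy, hne⟩, hxy⟩
    calc #{f : Fin n → Fin K | ¬ Set.InjOn f (H p)} * K
        ≤ (∑ q ∈ (H p).offDiag, #{f : Fin n → Fin K | f q.1 = f q.2}) * K :=
          Nat.mul_le_mul_right _ ((card_le_card hsub).trans card_biUnion_le)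
      _ = ∑ q ∈ (H p).offDiag, #{f : Fin n → Fin K | f q.1 = f q.2} * K := by rw [sum_mul]
      _ ≤ #(H p).offDiag • Fintype.card (Fin n → Fin K) :=
          sum_le_card_nsmul _ _ _ fun q hq =>
            card_colorings_collision_mul_le (mem_offDiag.1 hq).2.2
      _ ≤ T ^ 2 * Fintype.card (Fin n → Fin K) := by
          rw [smul_eq_mul]
          gcongr
          rw [offDiag_card, sq]
          exact (Nat.sub_le _ _).trans (Nat.mul_le_mul (hH p hp) (hH p hp))
  by_contra! hlt
  have h1 : ∑ f : Fin n → Fin K, #P * T ^ 2 <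
      ∑ f : Fin n → Fin K, #{p ∈ P | ¬ Set.InjOn f (H p)} * K :=
    sum_lt_sum_of_nonempty univ_nonempty fun f _ => hlt f
  have h2 : ∑ f : Fin n → Fin K, #{p ∈ P | ¬ Set.InjOn f (H p)} =
      ∑ p ∈ P, #{f : Fin n → Fin K | ¬ Set.InjOn f (H p)} :=
    sum_card_bipartiteAbove_eq_sum_card_bipartiteBelow (s := univ) (t := P)
      (fun (f : Fin n → Fin K) p => ¬ Set.InjOn f (H p))
  rw [sum_const, ← sum_mul, h2, sum_mul] at h1
  have h3 := sum_le_card_nsmul _ _ _ key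
  simp only [card_univ, smul_eq_mul] at h1 h3
  have : Fintype.card (Fin n → Fin K) * (#P * T ^ 2) =
    #P * (T ^ 2 * Fintype.card (Fin n → Fin K)) := by ring
  omega

open Finset in
/-- The Ruzsa–Szemerédi bound for families of bipartite matchings that are induced in their
union. -/
theorem RSBoundAt.sum_card_le {R : ℝ} {n : ℕ} (hRS : RSBoundAt R (2 * n))
    (M : Fin n → Finset (Fin n × Fin n))
    (hdisj : ∀ h h' p, p ∈ M h → p ∈ M h' → h = h')
    (hmatch : ∀ h, ∀ p ∈ M h, ∀ q ∈ M h, p.1 = q.1 ∨ p.2 = q.2 → p = q)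
    (hind : ∀ h h' u v u' v', (u, v) ∈ M h → (u', v') ∈ M h → (u, v') ∈ M h' →
      (u, v') ∈ M h) :
    ∑ h, (#(M h) : ℝ) ≤ (2 * n : ℝ) ^ 2 / R := by
  classical
  let iL : Fin n → Fin (2 * n) := fun u => ⟨u, by omega⟩
  let iR : Fin n → Fin (2 * n) := fun u => ⟨n + u, by omega⟩
  have hL : ∀ {u v}, iL u = iL v ↔ u = v := by simp [iL, Fin.ext_iff]
  have hR : ∀ {u v}, iR u = iR v ↔ u = v := by simp [iR, Fin.ext_iff]
  have hLR : ∀ {u v}, iL u ≠ iR v := by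
    intro u v h
    simp only [iL, iR, Fin.ext_iff] at h
    omega
  let e : Fin n × Fin n → Sym2 (Fin (2 * n)) := fun p => s(iL p.1, iR p.2)
  have he : Function.Injective e := by
    rintro ⟨u, v⟩ ⟨u', v'⟩ h
    simp only [e, Sym2.eq_iff, hL, hR, hLR, hLR.symm, false_and, or_false] at h
    exact Prod.ext h.1 h.2
  have hmemL : ∀ {u p}, iL u ∈ e p ↔ u = p.1 := by simp [e, hL, hLR]
  have hmemR : ∀ {v p}, iR v ∈ e p ↔ v = p.2 := by simp [e, hR, hLR.symm]
  let U : Finset (Fin n × Fin n) := univ.biUnion M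
  let G : SimpleGraph (Fin (2 * n)) := SimpleGraph.fromEdgeSet (e '' U)
  have hG : G.edgeSet = e '' U := by
    rw [SimpleGraph.edgeSet_fromEdgeSet, sdiff_eq_left, Set.disjoint_left]
    rintro _ ⟨p, -, rfl⟩ hd
    exact hLR (by simpa [e] using hd)
  let 𝓜 : Finset (Set (Sym2 (Fin (2 * n)))) := univ.image fun h => e '' (M h : Set _)
  have hcard : (G.edgeSet.ncard : ℝ) = ∑ h, (#(M h) : ℝ) := by
    rw [hG, Set.ncard_image_of_injective _ he, Set.ncard_coe_finset, card_biUnion]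
    · push_cast; rfl
    · intro h _ h' _ hne
      exact disjoint_left.2 fun p hp hp' => hne (hdisj h h' p hp hp')
  have := hRS G 𝓜 ?_ ?_ ?_ ?_
  · rw [hcard] at this
    exact_mod_cast this
  · exact card_image_le.trans (by simp; omega)
  · intro _ hM
    obtain ⟨h, -, rfl⟩ := mem_image.1 hM
    refine ⟨?_, ?_, ?_⟩
    · rw [hG]
      exact Set.image_mono fun p hp => mem_biUnion.2 ⟨h, mem_univ _, hp⟩
    · rintro _ ⟨p, hp, rfl⟩ _ ⟨q, hq, rfl⟩ hne x hx hx'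
      apply hne
      congr 1
      refine hmatch h p hp q hq ?_
      rcases Sym2.mem_iff.1 hx with rfl | rfl
      · exact Or.inl (hmemL.1 hx')
      · exact Or.inr (hmemR.1 hx')
    · rw [hG]
      rintro _ ⟨⟨u, v⟩, hp, rfl⟩ hcov
      obtain ⟨h', -, hp⟩ := mem_biUnion.1 (mem_coe.1 hp)
      obtain ⟨_, ⟨⟨u₁, v₁⟩, h1, rfl⟩, hu⟩ := hcov (iL u) (hmemL.2 rfl)
      obtain ⟨_, ⟨⟨u₂, v₂⟩, h2, rfl⟩, hv⟩ := hcov (iR v) (hmemR.2 rfl)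
      obtain rfl : u = u₁ := hmemL.1 hu
      obtain rfl : v = v₂ := hmemR.1 hv
      exact ⟨_, hind h h' _ _ _ _ h1 h2 hp, rfl⟩
  · intro _ h1 _ h2 hne
    obtain ⟨h, -, rfl⟩ := mem_image.1 h1
    obtain ⟨h', -, rfl⟩ := mem_image.1 h2
    rw [Set.disjoint_image_iff he, Set.disjoint_left]
    intro p hp hp'
    exact hne (by rw [hdisj h h' p hp hp'])
  · rw [hG]
    ext x
    simp only [𝓜, U, Set.mem_iUnion, mem_image, mem_univ, true_and, Set.mem_image, mem_coe,
      mem_biUnion]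
    constructor
    · rintro ⟨_, ⟨h, rfl⟩, p, hp, rfl⟩
      exact ⟨p, ⟨h, hp⟩, rfl⟩
    · rintro ⟨p, ⟨h, hp⟩, rfl⟩
      exact ⟨_, ⟨h, rfl⟩, p, hp, rfl⟩

open Finset in
/-- Every finite relation contains a matching whose endpoints cover it. -/
theorem exists_maximal_matching {α β : Type*} (E : Finset (α × β)) :
    ∃ M ⊆ E, (∀ p ∈ M, ∀ q ∈ M, p.1 = q.1 ∨ p.2 = q.2 → p = q) ∧
      ∀ p ∈ E, ∃ q ∈ M, p.1 = q.1 ∨ p.2 = q.2 := by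
  classical
  induction E using Finset.induction_on with
  | empty => exact ⟨∅, by simp⟩
  | insert x E _ ih =>
    obtain ⟨M, hME, hM, hcov⟩ := ih
    by_cases hx : ∃ q ∈ M, x.1 = q.1 ∨ x.2 = q.2
    · refine ⟨M, hME.trans (subset_insert _ _), hM, fun p hp => ?_⟩
      rcases mem_insert.1 hp with rfl | hp
      exacts [hx, hcov p hp]
    · push Not at hx
      refine ⟨insert x M, insert_subset_insert _ hME, ?_, ?_⟩
      · intro p hp q hq h
        rcases mem_insert.1 hp with hp' | hp' <;> rcases mem_insert.1 hq with hq' | hq'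
        · rw [hp', hq']
        · have := hx q hq'
          subst hp'
          tauto
        · have := hx p hp'
          subst hq'
          exact absurd h (by simpa [eq_comm] using this)
        · exact hM p hp' q hq' h
      · intro p hp
        rcases mem_insert.1 hp with rfl | hp
        · exact ⟨p, mem_insert_self _ _, Or.inl rfl⟩
        · obtain ⟨q, hq, h⟩ := hcov p hp
          exact ⟨q, mem_insert_of_mem hq, h⟩

namespace SimpleGraph

variable {V : Type*} {G : SimpleGraph V}

theorem Connected.exists_adj_dist_eq (hG : G.Connected) {u v : V} (h : u ≠ v) :
    ∃ w, G.Adj u w ∧ G.dist w v + 1 = G.dist u v := by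
  obtain ⟨p, hp⟩ := hG.exists_walk_length_eq_dist u v
  cases p with
  | nil => exact absurd rfl h
  | @cons _ w _ hadj q =>
    refine ⟨w, hadj, ?_⟩
    have h1 := dist_le q
    have h2 := hG.dist_triangle (u := u) (v := w) (w := v)
    have h3 : G.dist u w = 1 := dist_eq_one_iff_adj.2 hadj
    simp only [Walk.length_cons] at hp
    omega

theorem Connected.exists_dist_eq (hG : G.Connected) (u v : V) {i : ℕ} (hi : i ≤ G.dist u v) :
    ∃ w, G.dist u w = i ∧ G.dist u w + G.dist w v = G.dist u v := by
  induction i with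
  | zero => exact ⟨u, by simp⟩
  | succ i ih =>
    obtain ⟨w, hw, hwv⟩ := ih (by omega)
    have hne : w ≠ v := by
      rintro rfl
      omega
    obtain ⟨x, hx, hxv⟩ := hG.exists_adj_dist_eq hne
    have h1 := hG.dist_triangle (u := u) (v := x) (w := v)
    have h2 := hG.dist_triangle (u := u) (v := w) (w := x)
    have h3 : G.dist w x = 1 := dist_eq_one_iff_adj.2 hx
    exact ⟨x, by omega, by omega⟩

open Finset Classical in
/-- The vertices lying on some shortest path from `u` to `v`. -/
noncomputable def geodesicHull [Fintype V] (G : SimpleGraph V) (u v : V) : Finset V :=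
  {w | G.dist u w + G.dist w v = G.dist u v}

@[simp]
theorem mem_geodesicHull [Fintype V] {u v w : V} :
    w ∈ G.geodesicHull u v ↔ G.dist u w + G.dist w v = G.dist u v := by
  simp [geodesicHull]

open Finset in
theorem Connected.dist_lt_card_geodesicHull [Fintype V] (hG : G.Connected) (u v : V) :
    G.dist u v < #(G.geodesicHull u v) := by
  classical
  have : range (G.dist u v + 1) ⊆ (G.geodesicHull u v).image (G.dist u) := by
    intro i hi
    obtain ⟨w, hw, hwv⟩ := hG.exists_dist_eq u v (Nat.lt_succ_iff.1 (mem_range.1 hi))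
    exact mem_image.2 ⟨w, mem_geodesicHull.2 hwv, hw⟩
  simpa using (card_le_card this).trans card_image_le

open Finset in
/-- If every vertex of the geodesic hull of `u, v` is in `A` or `B`, then some vertex of the hull
is within distance one of both. -/
theorem Connected.exists_common_near [Fintype V] (hG : G.Connected) {u v : V} {A B : Finset V}
    (hu : u ∈ A) (hv : v ∈ B) (hAB : ∀ w ∈ G.geodesicHull u v, w ∈ A ∨ w ∈ B) :
    ∃ w ∈ G.geodesicHull u v, w ∈ A ∧ (w ∈ B ∨ ∃ x ∈ B, G.Adj x w) := by
  classical
  obtain ⟨w, hw, hmax⟩ := exists_max_image (G.geodesicHull u v ∩ A) (G.dist u)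
    ⟨u, by simp [hu]⟩
  obtain ⟨hwH, hwA⟩ := mem_inter.1 hw
  refine ⟨w, hwH, hwA, ?_⟩
  by_cases hwv : w = v
  · exact Or.inl (hwv ▸ hv)
  right
  obtain ⟨x, hx, hxv⟩ := hG.exists_adj_dist_eq hwv
  have h1 := hG.dist_triangle (u := u) (v := x) (w := v)
  have h2 := hG.dist_triangle (u := u) (v := w) (w := x)
  have h3 : G.dist w x = 1 := dist_eq_one_iff_adj.2 hx
  rw [mem_geodesicHull] at hwH
  have hxH : x ∈ G.geodesicHull u v := by
    rw [mem_geodesicHull]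
    omega
  refine ⟨x, (hAB x hxH).resolve_left fun hxA => ?_, hx.symm⟩
  have := hmax x (mem_inter.2 ⟨hxH, hxA⟩)
  omega

end SimpleGraph

open Finset Classical in
/-- For a vertex coloring `f`, hub sets such that each vertex on a shortest path between `u` and
`v` is a hub of `u` or of `v`, provided `u` and `v` are close and `f` is injective on their
geodesic hull. -/
theorem exists_half_hubs {n K : ℕ} (T : ℕ) {R : ℝ} (hRS : RSBoundAt R (2 * n))
    (G : SimpleGraph (Fin n)) (f : Fin n → Fin K) :
    ∃ Q : Fin n → Finset (Fin n),
      (∀ u v, Set.InjOn f (G.geodesicHull u v) → G.dist u v < T →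
        ∀ h ∈ G.geodesicHull u v, h ∈ Q u ∨ h ∈ Q v) ∧
      ∑ u, (#(Q u) : ℝ) ≤ 2 * (T ^ 2 * (K * ((2 * n : ℝ) ^ 2 / R))) := by
  let E : Fin n → ℕ → ℕ → Finset (Fin n × Fin n) := fun h a b =>
    {p | h ∈ G.geodesicHull p.1 p.2 ∧ G.dist p.1 h = a ∧ G.dist h p.2 = b ∧
      Set.InjOn f (G.geodesicHull p.1 p.2)}
  have hE : ∀ {h a b u v}, (u, v) ∈ E h a b ↔ h ∈ G.geodesicHull u v ∧ G.dist u h = a ∧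
      G.dist h v = b ∧ Set.InjOn f (G.geodesicHull u v) := by
    intro h a b u v
    simp only [E, mem_filter, mem_univ, true_and]
  choose M hME hM hcov using fun h a b => exists_maximal_matching (E h a b)
  have hsum : ∀ a b, ∑ h, (#(M h a b) : ℝ) ≤ K * ((2 * n : ℝ) ^ 2 / R) := by
    intro a b
    let N : Fin K → Fin n → Finset (Fin n × Fin n) := fun c h => if f h = c then M h a b else ∅
    have hN : ∀ {c h p}, p ∈ N c h ↔ f h = c ∧ p ∈ M h a b := by
      intro c h p
      by_cases hc : f h = c <;> simp [N, hc]
    have hc : ∀ c, ∑ h, (#(N c h) : ℝ) ≤ (2 * n : ℝ) ^ 2 / R := by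
      intro c
      refine hRS.sum_card_le (N c) ?_ ?_ ?_
      · rintro h h' ⟨u, v⟩ hp hp'
        rw [hN] at hp hp'
        obtain ⟨h1, -, -, hinj⟩ := hE.1 (hME _ _ _ hp.2)
        obtain ⟨h2, -, -, -⟩ := hE.1 (hME _ _ _ hp'.2)
        exact hinj h1 h2 (hp.1.trans hp'.1.symm)
      · intro h p hp q hq
        exact hM h a b p (hN.1 hp).2 q (hN.1 hq).2
      · intro h h' u v u' v' h1 h2 h3
        have h3' := h3
        rw [hN] at h1 h2 h3
        obtain ⟨-, h1a, -, -⟩ := hE.1 (hME _ _ _ h1.2)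
        obtain ⟨-, -, h2b, -⟩ := hE.1 (hME _ _ _ h2.2)
        obtain ⟨h3m, h3a, h3b, hinj⟩ := hE.1 (hME _ _ _ h3.2)
        have hm : h ∈ G.geodesicHull u v' := by
          rw [SimpleGraph.mem_geodesicHull] at h3m ⊢
          omega
        rwa [hinj hm h3m (h1.1.trans h3.1.symm)]
    calc ∑ h, (#(M h a b) : ℝ) = ∑ c, ∑ h, (#(N c h) : ℝ) := by
          rw [sum_comm]
          refine sum_congr rfl fun h _ => ?_
          rw [sum_eq_single (f h)]
          · simp [N]
          · intro c _ hc
            simp [N, hc.symm]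
          · simp
      _ ≤ ∑ _c : Fin K, (2 * n : ℝ) ^ 2 / R := sum_le_sum fun c _ => hc c
      _ = _ := by simp
  let U : Fin n → Finset (Fin n) := fun h => (range T ×ˢ range T).biUnion fun ab =>
    (M h ab.1 ab.2).image Prod.fst ∪ (M h ab.1 ab.2).image Prod.snd
  refine ⟨fun u => {h | u ∈ U h}, ?_, ?_⟩
  · intro u v hinj hT h hh
    have hlt := SimpleGraph.mem_geodesicHull.1 hh
    obtain ⟨q, hq, hor⟩ := hcov h _ _ (u, v) (hE.2 ⟨hh, rfl, rfl, hinj⟩)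
    simp only [mem_filter, mem_univ, true_and, U, mem_biUnion, mem_product, mem_range, mem_union,
      mem_image]
    rcases hor with hor | hor
    · exact Or.inl ⟨(G.dist u h, G.dist h v), ⟨by dsimp only; omega, by dsimp only; omega⟩,
        Or.inl ⟨q, hq, hor.symm⟩⟩
    · exact Or.inr ⟨(G.dist u h, G.dist h v), ⟨by dsimp only; omega, by dsimp only; omega⟩,
        Or.inr ⟨q, hq, hor.symm⟩⟩
  · have hswap : ∑ u, #({h | u ∈ U h} : Finset (Fin n)) = ∑ h, #(U h) := by
      have := sum_card_bipartiteAbove_eq_sum_card_bipartiteBelow (s := (univ : Finset (Fin n)))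
        (t := (univ : Finset (Fin n))) (fun u h => u ∈ U h)
      simpa only [bipartiteAbove, bipartiteBelow, filter_univ_mem] using this
    have hU : ∀ h, #(U h) ≤ ∑ ab ∈ range T ×ˢ range T, 2 * #(M h ab.1 ab.2) := by
      intro h
      refine card_biUnion_le.trans (sum_le_sum fun ab _ => (card_union_le _ _).trans ?_)
      rw [two_mul]
      exact add_le_add card_image_le card_image_le
    calc ∑ u, (#({h | u ∈ U h} : Finset (Fin n)) : ℝ) = ∑ h, (#(U h) : ℝ) := by
          exact_mod_cast hswap
      _ ≤ ∑ h, ∑ ab ∈ range T ×ˢ range T, 2 * (#(M h ab.1 ab.2) : ℝ) :=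
          sum_le_sum fun h _ => by exact_mod_cast hU h
      _ = 2 * ∑ ab ∈ range T ×ˢ range T, ∑ h, (#(M h ab.1 ab.2) : ℝ) := by
          rw [sum_comm]
          simp only [mul_sum]
      _ ≤ 2 * ∑ ab ∈ range T ×ˢ range T, K * ((2 * n : ℝ) ^ 2 / R) := by
          gcongr with ab
          exact hsum _ _
      _ = _ := by
          simp only [sum_const, card_product, card_range, nsmul_eq_mul]
          push_cast
          ring

open Finset Classical in
/-- Hub labelings from a hitting set for the large geodesic hulls, explicit labels for the pairs
with a repeated color, and half hubs extended to neighbors for the remaining pairs. -/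
theorem exists_isHubLabeling_card_le {n K T Δ : ℕ} {R d : ℝ} (hn : 0 < n) (hK : 0 < K)
    (hdn : d ≤ n) (hdT : d ≤ T) (hRS : RSBoundAt R (2 * n))
    {G : SimpleGraph (Fin n)} (hG : G.Connected)
    (hΔ : ∀ v, (G.neighborSet v).ncard ≤ Δ) (t : ℕ) :
    ∃ S : Fin n → Finset (Fin n), IsHubLabeling G S ∧
      ∑ v, (#(S v) : ℝ) ≤ n * t + (1 - d / n) ^ t * n ^ 2 + n ^ 2 * T ^ 2 / K +
        (Δ + 1) * (n + 2 * (T ^ 2 * (K * ((2 * n : ℝ) ^ 2 / R)))) := by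
  let H : Fin n × Fin n → Finset (Fin n) := fun p => G.geodesicHull p.1 p.2
  let L : Finset (Fin n × Fin n) := {p | T ≤ #(H p)}
  let P : Finset (Fin n × Fin n) := {p | #(H p) < T}
  have hcard : ∀ A : Finset (Fin n × Fin n), #A ≤ n ^ 2 := fun A => by
    simpa [sq] using card_le_univ A
  obtain ⟨W, hW, hWL⟩ := exists_hitting_set L H d hn hdn (fun p hp => hdT.trans <| by
    exact_mod_cast (mem_filter.1 hp).2) t
  obtain ⟨f, hf⟩ := exists_coloring hK P H fun p hp => (mem_filter.1 hp).2.le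
  obtain ⟨Q, hQ, hQcard⟩ := exists_half_hubs T hRS G f
  let B₁ : Finset (Fin n × Fin n) := {p ∈ L | Disjoint (H p) W}
  let B₂ : Finset (Fin n × Fin n) := {p ∈ P | ¬ Set.InjOn f (H p)}
  let X : Finset (Fin n × Fin n) → Fin n → Finset (Fin n) := fun A u => {v | (u, v) ∈ A}
  have hX : ∀ A : Finset (Fin n × Fin n), ∑ u, #(X A u) = #A := by
    intro A
    rw [← card_sigma]
    refine card_bij (fun x _ => (x.1, x.2)) ?_ ?_ ?_
    · rintro ⟨u, v⟩ h
      simpa [X] using h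
    · rintro ⟨u, v⟩ _ ⟨u', v'⟩ _ h
      simp only [Prod.mk.injEq] at h
      obtain ⟨rfl, rfl⟩ := h
      rfl
    · rintro ⟨u, v⟩ h
      exact ⟨⟨u, v⟩, by simpa [X] using h, rfl⟩
  let Q' : Fin n → Finset (Fin n) := fun u => insert u (Q u)
  let N : Fin n → Finset (Fin n) := fun u => Q' u ∪ (Q' u).biUnion fun x => G.neighborFinset x
  have hN : ∀ u, #(N u) ≤ (Δ + 1) * (1 + #(Q u)) := by
    intro u
    have h1 : #(Q' u) ≤ 1 + #(Q u) := by
      rw [add_comm]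
      exact card_insert_le _ _
    have h2 : #((Q' u).biUnion fun x => G.neighborFinset x) ≤ #(Q' u) * Δ :=
      card_biUnion_le_card_mul _ _ _ fun x _ => by
        simpa [SimpleGraph.neighborFinset, Set.ncard_eq_toFinset_card'] using hΔ x
    calc #(N u) ≤ #(Q' u) + #(Q' u) * Δ := (card_union_le _ _).trans (by gcongr)
      _ = (Δ + 1) * #(Q' u) := by ring
      _ ≤ _ := by gcongr
  have hself : ∀ u, u ∈ N u := fun u => mem_union_left _ (mem_insert_self _ _)
  refine ⟨fun u => W ∪ X B₁ u ∪ X B₂ u ∪ N u, ?_, ?_⟩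
  · intro u v
    simp only [mem_union]
    by_cases hL : T ≤ #(H (u, v))
    · by_cases hdis : Disjoint (H (u, v)) W
      · have : v ∈ X B₁ u := by simp [X, B₁, L, hL, hdis]
        exact ⟨v, by tauto, Or.inr (hself v), by simp⟩
      · obtain ⟨w, hw, hwW⟩ := not_disjoint_iff.1 hdis
        exact ⟨w, by tauto, by tauto, SimpleGraph.mem_geodesicHull.1 hw⟩
    · push Not at hL
      by_cases hinj : Set.InjOn f (H (u, v))
      · obtain ⟨w, hw, hwu, hwv⟩ := hG.exists_common_near (u := u) (v := v) (A := Q' u) (B := Q' v)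
          (mem_insert_self _ _) (mem_insert_self _ _) fun w hw =>
            (hQ u v hinj ((hG.dist_lt_card_geodesicHull u v).trans hL) w hw).imp
              mem_insert_of_mem mem_insert_of_mem
        refine ⟨w, Or.inr (mem_union_left _ hwu), Or.inr ?_, SimpleGraph.mem_geodesicHull.1 hw⟩
        rcases hwv with hwv | ⟨x, hx, hxw⟩
        · exact mem_union_left _ hwv
        · exact mem_union_right _ (mem_biUnion.2 ⟨x, hx, by simpa using hxw⟩)
      · have : v ∈ X B₂ u := by
          simp only [X, B₂, P, mem_filter, mem_univ, true_and]
          exact ⟨hL, hinj⟩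
        exact ⟨v, by tauto, Or.inr (hself v), by simp⟩
  · have hn' : (0 : ℝ) < n := by exact_mod_cast hn
    have hK' : (0 : ℝ) < K := by exact_mod_cast hK
    have hle : ∀ u, (#(W ∪ X B₁ u ∪ X B₂ u ∪ N u) : ℝ) ≤
        t + #(X B₁ u) + #(X B₂ u) + (Δ + 1) * (1 + #(Q u)) := by
      intro u
      have h1 := card_union_le (W ∪ X B₁ u ∪ X B₂ u) (N u)
      have h2 := card_union_le (W ∪ X B₁ u) (X B₂ u)
      have h3 := card_union_le W (X B₁ u)
      have h4 := hN u
      have : #(W ∪ X B₁ u ∪ X B₂ u ∪ N u) ≤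
          t + #(X B₁ u) + #(X B₂ u) + (Δ + 1) * (1 + #(Q u)) := by omega
      exact_mod_cast this
    have hB₁ : (#B₁ : ℝ) ≤ (1 - d / n) ^ t * n ^ 2 := by
      refine hWL.trans ?_
      have : 0 ≤ 1 - d / n := by
        rw [sub_nonneg, div_le_one hn']
        exact hdn
      gcongr
      exact_mod_cast hcard L
    have hB₂ : (#B₂ : ℝ) ≤ n ^ 2 * T ^ 2 / K := by
      rw [le_div_iff₀ hK']
      exact_mod_cast hf.trans (Nat.mul_le_mul_right _ (hcard P))
    have hX₁ : ∑ u, (#(X B₁ u) : ℝ) = #B₁ := by exact_mod_cast hX B₁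
    have hX₂ : ∑ u, (#(X B₂ u) : ℝ) = #B₂ := by exact_mod_cast hX B₂
    calc ∑ u, (#(W ∪ X B₁ u ∪ X B₂ u ∪ N u) : ℝ)
        ≤ ∑ u : Fin n, ((t : ℝ) + #(X B₁ u) + #(X B₂ u) + (Δ + 1) * (1 + #(Q u))) :=
          sum_le_sum fun u _ => hle u
      _ = n * t + #B₁ + #B₂ + (Δ + 1) * (n + ∑ u, (#(Q u) : ℝ)) := by
          simp only [sum_add_distrib, ← mul_sum, hX₁, hX₂]
          simp
      _ ≤ _ := by gcongr

/-- There is an absolute constant `C > 0` such that: if `2^6 ≤ R ≤ n^6` and the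
Ruzsa–Szemerédi bound with parameter `R` holds at `2n`, then every connected graph on `n ≥ 2`
vertices with maximum degree at most `Δ` has a hub labeling of total size at most
`C·(Δ+1)·n²/R^{1/7}`. -/
theorem hub_labeling_upper_bound_max_degree :
    ∃ C : ℝ, 0 < C ∧
      ∀ n Δ : ℕ, 2 ≤ n →
        ∀ R : ℝ, (2 : ℝ) ^ 6 ≤ R → R ≤ (n : ℝ) ^ 6 → RSBoundAt R (2 * n) →
          ∀ G : SimpleGraph (Fin n), G.Connected →
            (∀ v : Fin n, (G.neighborSet v).ncard ≤ Δ) →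
            ∃ S : Fin n → Finset (Fin n), IsHubLabeling G S ∧
              (∑ v : Fin n, ((S v).card : ℝ)) ≤
                C * ((Δ : ℝ) + 1) * (n : ℝ) ^ 2 / R ^ ((1 : ℝ) / 7) := by
  refine ⟨1000, by norm_num, fun n Δ hn R hR hRn hRS G hG hΔ => ?_⟩
  have hR0 : 0 < R := lt_of_lt_of_le (by norm_num) hR
  have hn0 : (0 : ℝ) < n := by exact_mod_cast (by omega : 0 < n)
  set d : ℝ := R ^ ((1 : ℝ) / 6) with hd_def
  set q : ℝ := R ^ ((1 : ℝ) / 7) with hq_def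
  set x : ℝ := R ^ ((1 : ℝ) / 42) with hx_def
  have hd0 : 0 < d := Real.rpow_pos_of_pos hR0 _
  have hq0 : 0 < q := Real.rpow_pos_of_pos hR0 _
  have hx0 : 0 < x := Real.rpow_pos_of_pos hR0 _
  have hd6 : d ^ 6 = R := by
    rw [hd_def, ← Real.rpow_mul_natCast hR0.le]
    norm_num
  have hx6 : x ^ 6 = q := by
    rw [hx_def, hq_def, ← Real.rpow_mul_natCast hR0.le]
    norm_num
  have hqx : d = q * x := by
    rw [hd_def, hq_def, hx_def, ← Real.rpow_add hR0]
    norm_num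
  have hx1 : 1 ≤ x := Real.one_le_rpow (by norm_num at hR; linarith) (by norm_num)
  have hqd : q ≤ d := by
    rw [hqx]
    exact le_mul_of_one_le_right hq0.le hx1
  have hd2 : 2 ≤ d := le_of_pow_le_pow_left₀ (n := 6) (by norm_num) hd0.le (by rwa [hd6])
  have hdn : d ≤ n := le_of_pow_le_pow_left₀ (n := 6) (by norm_num) hn0.le (by rwa [hd6])
  set T := ⌈d⌉₊
  have hdT : d ≤ T := Nat.le_ceil d
  have hT0 : (0 : ℝ) < T := hd0.trans_le hdT
  have hT2 : (T : ℝ) ≤ 2 * d := by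
    have := Nat.ceil_lt_add_one hd0.le
    linarith
  set t := ⌈(n : ℝ) * x / d⌉₊
  obtain ⟨S, hS, hcard⟩ := exists_isHubLabeling_card_le (K := T ^ 3) (by omega)
    (by have : 0 < T := by exact_mod_cast hT0
        positivity) hdn hdT hRS hG hΔ t
  refine ⟨S, hS, hcard.trans ?_⟩
  set A : ℝ := (n : ℝ) ^ 2 / q with hA_def
  have hA0 : 0 < A := by positivity
  have hnA : (n : ℝ) ≤ A := by
    rw [hA_def, le_div_iff₀ hq0, sq]
    gcongr
    exact hqd.trans hdn
  have hdA : (n : ℝ) ^ 2 / d ≤ A := by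
    rw [hA_def]
    gcongr
  have h1 : (n : ℝ) * t ≤ 2 * A := by
    have ht : (t : ℝ) ≤ n * x / d + 1 := (Nat.ceil_lt_add_one (by positivity)).le
    calc (n : ℝ) * t ≤ n * (n * x / d + 1) := by gcongr
      _ = A + n := by
        rw [hA_def, hqx]
        field_simp
      _ ≤ 2 * A := by linarith
  have h2 : (1 - d / n) ^ t * (n : ℝ) ^ 2 ≤ 720 * A := by
    have hexp : (1 - d / n) ^ t ≤ Real.exp (-x) := by
      have hbase : 0 ≤ 1 - d / n := by
        rw [sub_nonneg, div_le_one hn0]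
        exact hdn
      calc (1 - d / n) ^ t ≤ Real.exp (-(d / n)) ^ t := by
            gcongr
            exact Real.one_sub_le_exp_neg _
        _ = Real.exp (-(t * (d / n))) := by
            rw [← Real.exp_nat_mul]
            ring_nf
        _ ≤ Real.exp (-x) := by
            rw [Real.exp_le_exp, neg_le_neg_iff]
            have ht : (n : ℝ) * x / d ≤ t := Nat.le_ceil _
            calc x = n * x / d * (d / n) := by field_simp
              _ ≤ t * (d / n) := by gcongr
    have hpow : q ≤ 720 * Real.exp x := by
      have := Real.pow_div_factorial_le_exp x hx0.le 6
      rw [hx6, div_le_iff₀ (by positivity)] at this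
      norm_num [Nat.factorial] at this
      linarith
    have : Real.exp (-x) ≤ 720 / q := by
      rw [Real.exp_neg, inv_le_comm₀ (Real.exp_pos _) (by positivity), inv_div,
        div_le_iff₀ (by norm_num)]
      linarith
    calc (1 - d / n) ^ t * (n : ℝ) ^ 2 ≤ 720 / q * (n : ℝ) ^ 2 := by
          gcongr
          exact hexp.trans this
      _ = 720 * A := by
          rw [hA_def]
          ring
  have h3 : (n : ℝ) ^ 2 * (T : ℝ) ^ 2 / ((T ^ 3 : ℕ) : ℝ) ≤ A := by
    refine le_trans ?_ hdA
    calc (n : ℝ) ^ 2 * (T : ℝ) ^ 2 / ((T ^ 3 : ℕ) : ℝ) = (n : ℝ) ^ 2 / T := by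
          push_cast
          field_simp
      _ ≤ (n : ℝ) ^ 2 / d := by gcongr
  have h4 : 2 * ((T : ℝ) ^ 2 * (((T ^ 3 : ℕ) : ℝ) * ((2 * n : ℝ) ^ 2 / R))) ≤ 256 * A := by
    calc 2 * ((T : ℝ) ^ 2 * (((T ^ 3 : ℕ) : ℝ) * ((2 * n : ℝ) ^ 2 / R)))
        = 8 * (T : ℝ) ^ 5 * ((n : ℝ) ^ 2 / R) := by
          push_cast
          ring
      _ ≤ 8 * (2 * d) ^ 5 * ((n : ℝ) ^ 2 / R) := by gcongr
      _ = 256 * ((n : ℝ) ^ 2 / d) := by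
          rw [← hd6]
          field_simp
          norm_num
      _ ≤ 256 * A := by gcongr
  have hΔ0 : (0 : ℝ) ≤ Δ := Nat.cast_nonneg _
  have h5 : ((Δ : ℝ) + 1) * (n + 2 * ((T : ℝ) ^ 2 * (((T ^ 3 : ℕ) : ℝ) * ((2 * n : ℝ) ^ 2 / R)))) ≤
      (Δ + 1) * (257 * A) := by
    gcongr
    linarith
  have h6 : 1000 * ((Δ : ℝ) + 1) * (n : ℝ) ^ 2 / q = (Δ + 1) * (1000 * A) := by
    rw [hA_def]
    ring
  rw [h6]
  nlinarith [mul_nonneg hΔ0 hA0.le]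
end
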